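/- Let T ∈ (0,∞) and suppose (u,v) is a Schwartz class solution of the Boussinesq system v_t = u_x + (u²)_x + u_{xxx}, u_t = v_x on [0,∞)×[0,T] with initial data u₀, v₀ ∈ 𝒮(ℝ₊) and boundary values ũ₀, ũ₁, ũ₂, ṽ₀ ∈ C^∞([0,T]). For t ∈ [0,T] let μ₃(x,t,k) be the eigenfunction whose j-th column is the unique bounded continuous solution on [0,∞) of c(x) = e_j − ∫_x^{+∞} e^{(x−x′)(ℒ(k) − l_j(k)I)} 𝖴(x′,t,k) c(x′) dx′ for k ∈ ω^{3−j}Ŝ₃ ∖ Q̂, where 𝖴 is built from u(·,t), v(·,t); let μ₁(t,k) be the unique continuous solution on [0,T] of the t-Volterra equation built from the boundary values, and set s(k) := μ₃(0,0,k), S(k) := μ₁(0,k). Then for each j ∈ {1,2,3}, each k ∈ ω^{3−j}Ŝ₃ ∖ Q̂, and each i ∈ {1,2,3}: (S(k)^{-1} s(k))_{ij} = e^{−T(z_i(k) − z_j(k))} · (μ₃(0,T,k))_{ij}. (Global relation: S^{-1}s = e^{−T 𝒵̂} μ₃(0,T,·).) -/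

import Mathlib

noncomputable section

open MeasureTheory Set

/-- 𝒮(ℝ₊): smooth functions on [0,∞) decaying, with all derivatives, faster than
any power of x as x → +∞. -/
def SchwartzHalfW (f : ℝ → ℝ) : Prop :=
  ContDiffOn ℝ (⊤ : ℕ∞) f (Ici 0) ∧
  ∀ n N : ℕ, ∃ C : ℝ, ∀ x : ℝ, 0 ≤ x →
    (1 + x) ^ N * |iteratedDerivWithin n f (Ici 0) x| ≤ C

/-- C^∞([0,T]). -/
def SmoothOnIcc (T : ℝ) (f : ℝ → ℝ) : Prop := ContDiffOn ℝ (⊤ : ℕ∞) f (Icc 0 T)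

/-- n-th partial derivative in x (within [0,∞)) of a function u = u(x,t). -/
def dxn (n : ℕ) (u : ℝ → ℝ → ℝ) (t x : ℝ) : ℝ :=
  iteratedDerivWithin n (fun y => u y t) (Ici 0) x

/-- Partial derivative in t (within [0,T]) of a function u = u(x,t). -/
def dt1 (T : ℝ) (u : ℝ → ℝ → ℝ) (x t : ℝ) : ℝ :=
  derivWithin (fun s => u x s) (Icc 0 T) t

/-- Schwartz class solution of the Boussinesq system v_t = u_x + (u²)_x + u_xxx,
u_t = v_x on [0,∞)×[0,T], with the given initial and boundary values and rapid decay. -/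
def IsSolSystem (T : ℝ) (u v : ℝ → ℝ → ℝ) (u0 v0 tu0 tu1 tu2 tv0 : ℝ → ℝ) : Prop :=
  ContDiffOn ℝ (⊤ : ℕ∞) (fun p : ℝ × ℝ => u p.1 p.2) (Ici 0 ×ˢ Icc 0 T) ∧
  ContDiffOn ℝ (⊤ : ℕ∞) (fun p : ℝ × ℝ => v p.1 p.2) (Ici 0 ×ˢ Icc 0 T) ∧
  (∀ x ∈ Ici (0:ℝ), ∀ t ∈ Icc (0:ℝ) T,
    dt1 T v x t = dxn 1 u t x + dxn 1 (fun y s => u y s ^ 2) t x + dxn 3 u t x ∧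
    dt1 T u x t = dxn 1 v t x) ∧
  (∀ x ∈ Ici (0:ℝ), u x 0 = u0 x ∧ v x 0 = v0 x) ∧
  (∀ t ∈ Icc (0:ℝ) T,
    u 0 t = tu0 t ∧ dxn 1 u t 0 = tu1 t ∧ dxn 2 u t 0 = tu2 t ∧ v 0 t = tv0 t) ∧
  (∀ N : ℕ, 1 ≤ N → ∃ C : ℝ, ∀ x ∈ Ici (0:ℝ), ∀ t ∈ Icc (0:ℝ) T,
    (∑ i ∈ Finset.range (N + 1), (1 + x) ^ N * (|dxn i u t x| + |dxn i v t x|)) ≤ C)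

/-- Schwartz class solution of the Boussinesq equation u_tt = u_xx + (u²)_xx + u_xxxx
on [0,∞)×[0,T], with the given initial and boundary values and rapid decay. -/
def IsSolEq (T : ℝ) (u : ℝ → ℝ → ℝ) (u0 u1 tu0 tu1 tu2 tu3 : ℝ → ℝ) : Prop :=
  ContDiffOn ℝ (⊤ : ℕ∞) (fun p : ℝ × ℝ => u p.1 p.2) (Ici 0 ×ˢ Icc 0 T) ∧
  (∀ x ∈ Ici (0:ℝ), ∀ t ∈ Icc (0:ℝ) T,
    iteratedDerivWithin 2 (fun s => u x s) (Icc 0 T) t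
      = dxn 2 u t x + dxn 2 (fun y s => u y s ^ 2) t x + dxn 4 u t x) ∧
  (∀ x ∈ Ici (0:ℝ), u x 0 = u0 x ∧ dt1 T u x 0 = u1 x) ∧
  (∀ t ∈ Icc (0:ℝ) T,
    u 0 t = tu0 t ∧ dxn 1 u t 0 = tu1 t ∧ dxn 2 u t 0 = tu2 t ∧ dxn 3 u t 0 = tu3 t) ∧
  (∀ N : ℕ, 1 ≤ N → ∃ C : ℝ, ∀ x ∈ Ici (0:ℝ), ∀ t ∈ Icc (0:ℝ) T,
    (∑ i ∈ Finset.range (N + 1), (1 + x) ^ N * |dxn i u t x|) ≤ C)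

open Matrix

/-- ω = e^{2πi/3}. -/
def ω : ℂ := Complex.exp (2 * Real.pi * Complex.I / 3)

/-- l_j(k) = i(ω^j k + (ω^j k)⁻¹)/(2√3), with `j : Fin 3` encoding the index j+1 ∈ {1,2,3}. -/
def lf (j : Fin 3) (k : ℂ) : ℂ :=
  Complex.I * (ω ^ (j.val + 1) * k + (ω ^ (j.val + 1) * k)⁻¹) / (2 * (Real.sqrt 3 : ℂ))

/-- z_j(k) = i((ω^j k)² + (ω^j k)^{-2})/(4√3). -/
def zf (j : Fin 3) (k : ℂ) : ℂ :=
  Complex.I * ((ω ^ (j.val + 1) * k) ^ 2 + ((ω ^ (j.val + 1) * k) ^ 2)⁻¹) / (4 * (Real.sqrt 3 : ℂ))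

/-- P(k): rows (1,1,1), (l₁,l₂,l₃), (l₁²,l₂²,l₃²). -/
def Pmat (k : ℂ) : Matrix (Fin 3) (Fin 3) ℂ := Matrix.of fun i j => lf j k ^ (i.val)

/-- Q: the sixth roots of unity. -/
def Qset : Set ℂ := {k : ℂ | k ^ 6 = 1}

/-- Q̂ = Q ∪ {0}. -/
def Qhat : Set ℂ := insert 0 Qset

/-- 𝒮₃ = {Re l₃ < Re l₁} ∩ {Re l₃ < Re l₂}. -/
def S3 : Set ℂ := {k : ℂ | k ≠ 0 ∧ (lf 2 k).re < (lf 0 k).re ∧ (lf 2 k).re < (lf 1 k).re}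

/-- Ŝ₃ = ∂𝔻 ∪ cl(𝒮₃). -/
def S3hat : Set ℂ := Metric.sphere (0:ℂ) 1 ∪ closure S3

/-- ω^{3−j}Ŝ₃, where `j : Fin 3` encodes the index j+1 ∈ {1,2,3}. -/
def domS3 (j : Fin 3) : Set ℂ := (fun w => ω ^ (2 - j.val) * w) '' S3hat

/-- The lower-triangular matrix N(t) built from the boundary values
(ũ₀′ taken within [0,T]). -/
def NmatW (T : ℝ) (tu0 tu1 tu2 tv0 : ℝ → ℝ) (t : ℝ) : Matrix (Fin 3) (Fin 3) ℂ :=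
  !![-Complex.I * (tu0 t : ℂ) / (Real.sqrt 3 : ℂ), 0, 0;
     -Complex.I * (tu1 t : ℂ) / (4 * (Real.sqrt 3 : ℂ)) - (tv0 t : ℂ) / 4,
       Complex.I * (tu0 t : ℂ) / (2 * (Real.sqrt 3 : ℂ)), 0;
     -Complex.I * (tu2 t : ℂ) / (4 * (Real.sqrt 3 : ℂ))
         - ((derivWithin tu0 (Icc 0 T) t : ℝ) : ℂ) / 4,
       Complex.I * (tu1 t : ℂ) / (4 * (Real.sqrt 3 : ℂ)) - (tv0 t : ℂ) / 4,
       Complex.I * (tu0 t : ℂ) / (2 * (Real.sqrt 3 : ℂ))]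

/-- 𝖵(t,k) = P(k)⁻¹ N(t) P(k). -/
def VmatW (T : ℝ) (tu0 tu1 tu2 tv0 : ℝ → ℝ) (t : ℝ) (k : ℂ) : Matrix (Fin 3) (Fin 3) ℂ :=
  (Pmat k)⁻¹ * NmatW T tu0 tu1 tu2 tv0 t * Pmat k

/-- μ is a continuous solution on [0,T] of the t-Volterra equation
μ(t) = I − ∫_t^T e^{(t−t′)Ẑ(k)}(𝖵 μ)(t′) dt′, entrywise. -/
def SolvesTW (T : ℝ) (tu0 tu1 tu2 tv0 : ℝ → ℝ) (k : ℂ)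
    (μ : ℝ → Matrix (Fin 3) (Fin 3) ℂ) : Prop :=
  (∀ i j : Fin 3, ContinuousOn (fun t => μ t i j) (Set.Icc 0 T)) ∧
  (∀ t ∈ Set.Icc (0:ℝ) T, ∀ i j : Fin 3,
    μ t i j = (if i = j then 1 else 0) -
      ∫ t' in t..T, Complex.exp (((t : ℂ) - (t' : ℂ)) * (zf i k - zf j k)) *
        ((VmatW T tu0 tu1 tu2 tv0 t' k) * μ t') i j)

/-- E(x,t) with only nonzero entries E₃₁ = −u_x(x,t)/4 − i v(x,t)/(4√3),
E₃₂ = −u(x,t)/2. -/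
def EmatSol (u v : ℝ → ℝ → ℝ) (t x : ℝ) : Matrix (Fin 3) (Fin 3) ℂ :=
  !![0, 0, 0; 0, 0, 0;
     -((dxn 1 u t x : ℝ) : ℂ) / 4 - Complex.I * (v x t : ℂ) / (4 * (Real.sqrt 3 : ℂ)),
     -(u x t : ℂ) / 2, 0]

/-- 𝖴(x,t,k) = P(k)⁻¹ E(x,t) P(k). -/
def UmatSol (u v : ℝ → ℝ → ℝ) (t x : ℝ) (k : ℂ) : Matrix (Fin 3) (Fin 3) ℂ :=
  (Pmat k)⁻¹ * EmatSol u v t x * Pmat k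

/-- c is a bounded continuous solution on [0,∞) of the j-th column x-Volterra equation
at time t: c(x) = e_j − ∫_x^∞ e^{(x−x′)(ℒ(k) − l_j(k)I)} 𝖴(x′,t,k) c(x′) dx′. -/
def SolvesXColSol (u v : ℝ → ℝ → ℝ) (t : ℝ) (k : ℂ) (j : Fin 3)
    (c : ℝ → Fin 3 → ℂ) : Prop :=
  (∀ i : Fin 3, ContinuousOn (fun x => c x i) (Set.Ici 0)) ∧
  (∃ C : ℝ, ∀ x ∈ Set.Ici (0:ℝ), ‖c x‖ ≤ C) ∧
  (∀ x ∈ Set.Ici (0:ℝ), ∀ i : Fin 3,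
    c x i = (if i = j then 1 else 0) -
      ∫ x' in Set.Ioi x, Complex.exp (((x : ℂ) - (x' : ℂ)) * (lf i k - lf j k)) *
        ((UmatSol u v t x' k).mulVec (c x')) i)

open Filter Topology

/-- The real-linear continuous operator on `Fin 3 → ℂ` given by a complex matrix. -/
def opOf (M : Matrix (Fin 3) (Fin 3) ℂ) : (Fin 3 → ℂ) →L[ℝ] (Fin 3 → ℂ) :=
  LinearMap.toContinuousLinearMap (M.mulVecLin.restrictScalars ℝ)

lemma opOf_apply (M : Matrix (Fin 3) (Fin 3) ℂ) (w : Fin 3 → ℂ) :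
    opOf M w = M *ᵥ w := rfl

lemma opOf_add (M N : Matrix (Fin 3) (Fin 3) ℂ) : opOf (M + N) = opOf M + opOf N := by
  ext w : 1
  simp [opOf_apply, Matrix.add_mulVec]

lemma opOf_smul (a : ℝ) (M : Matrix (Fin 3) (Fin 3) ℂ) :
    opOf ((a : ℂ) • M) = a • opOf M := by
  ext w i
  simp [opOf_apply, Matrix.smul_mulVec]

lemma hasDerivAt_weight (C : ℝ) {x : ℝ} (hx : 0 < x) :
    HasDerivAt (fun y : ℝ => Real.exp (-(C / (1 + y))))
      (Real.exp (-(C / (1 + x))) * (C / (1 + x) ^ 2)) x := by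
  have h1 : HasDerivAt (fun y : ℝ => 1 + y) 1 x := (hasDerivAt_id x).const_add 1
  have h2 := ((h1.fun_inv (by positivity)).const_mul (-C)).exp
  convert h2 using 1
  · ext y
    simp [div_eq_mul_inv]
  · simp only [div_eq_mul_inv, neg_mul]
    ring

/-- Weighted energy estimate, integrated from infinity, for a diagonal system whose
eigenvalues have nonnegative real parts. -/
lemma energy_estimate {d : Fin 3 → ℂ} (hd : ∀ i, 0 ≤ (d i).re) {r F : ℝ → Fin 3 → ℂ} {C β : ℝ}
    (hC : 0 ≤ C) (hβ : 0 ≤ β) (hcont : ContinuousOn r (Ici 0))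
    (hr : ∀ x, 0 < x → HasDerivAt r (opOf (diagonal d) (r x) + F x) x)
    (hF : ∀ x, 0 < x → ‖F x‖ ≤ C / (1 + x) ^ 2 * (‖r x‖ + β))
    (hlim : Tendsto r atTop (𝓝 0)) :
    ‖r 0‖ ≤ Real.exp (9 * C) * β := by
  set φ : ℝ → ℝ := fun x => ∑ i, ((r x i).re ^ 2 + (r x i).im ^ 2) with hφ
  have hri : ∀ i x, 0 < x → HasDerivAt (fun y => r y i) (d i * r x i + F x i) x := by
    intro i x hx
    have := (hasDerivAt_pi.1 (hr x hx)) i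
    simpa [opOf_apply, Matrix.mulVec_diagonal] using this
  have hφd : ∀ x, 0 < x → HasDerivAt φ (∑ i, (2 * (r x i).re * (d i * r x i + F x i).re
      + 2 * (r x i).im * (d i * r x i + F x i).im)) x := by
    intro x hx
    apply HasDerivAt.fun_sum
    intro i _
    have h1 : HasDerivAt (fun y => (r y i).re) (d i * r x i + F x i).re x :=
      (Complex.reCLM.hasFDerivAt.comp_hasDerivAt x (hri i x hx))
    have h2 : HasDerivAt (fun y => (r y i).im) (d i * r x i + F x i).im x :=
      (Complex.imCLM.hasFDerivAt.comp_hasDerivAt x (hri i x hx))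
    have h3 := (h1.fun_pow 2).fun_add (h2.fun_pow 2)
    simpa using h3
  have hφcont : ContinuousOn φ (Ici 0) := by
    have : ∀ i, ContinuousOn (fun y => r y i) (Ici 0) := fun i => by fun_prop
    have h1 : ∀ i, ContinuousOn (fun y => (r y i).re) (Ici 0) := fun i =>
      Complex.continuous_re.comp_continuousOn (this i)
    have h2 : ∀ i, ContinuousOn (fun y => (r y i).im) (Ici 0) := fun i =>
      Complex.continuous_im.comp_continuousOn (this i)
    exact continuousOn_finsetSum _ fun i _ => ((h1 i).pow 2).add ((h2 i).pow 2)
  have hsq : ∀ x, ‖r x‖ ^ 2 ≤ φ x := by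
    intro x
    obtain ⟨i, hi⟩ : ∃ i, ‖r x‖ ≤ ‖r x i‖ := by
      by_contra! hcon
      exact lt_irrefl _ ((pi_norm_lt_iff ((norm_nonneg _).trans_lt (hcon 0))).2 hcon)
    calc ‖r x‖ ^ 2 ≤ ‖r x i‖ ^ 2 := by gcongr
      _ = (r x i).re ^ 2 + (r x i).im ^ 2 := by
        rw [Complex.sq_norm, Complex.normSq_apply]; ring
      _ ≤ φ x := Finset.single_le_sum (f := fun i => (r x i).re ^ 2 + (r x i).im ^ 2)
          (fun i _ => by positivity) (Finset.mem_univ i)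
  set ψ : ℝ → ℝ := fun x => (φ x + β ^ 2 / 3) * Real.exp (-(9 * C / (1 + x))) with hψ
  have hψd : ∀ x, 0 < x → ∃ D, 0 ≤ D ∧ HasDerivAt ψ D x := by
    intro x hx
    refine ⟨_, ?_, ((hφd x hx).add_const (β ^ 2 / 3)).mul (hasDerivAt_weight (9 * C) hx)⟩
    have hterm : ∀ i, -(2 * (C / (1 + x) ^ 2) * (‖r x‖ * (‖r x‖ + β))) ≤
        2 * (r x i).re * (d i * r x i + F x i).re
          + 2 * (r x i).im * (d i * r x i + F x i).im := by
      intro i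
      have e1 : 2 * (r x i).re * (d i * r x i + F x i).re
          + 2 * (r x i).im * (d i * r x i + F x i).im =
          2 * (d i).re * ((r x i).re ^ 2 + (r x i).im ^ 2)
          + 2 * ((starRingEnd ℂ) (r x i) * F x i).re := by
        simp; ring
      have e2 : |((starRingEnd ℂ) (r x i) * F x i).re| ≤ ‖r x‖ * (C / (1 + x) ^ 2 * (‖r x‖ + β)) := by
        refine (Complex.abs_re_le_norm _).trans ?_
        rw [norm_mul, RCLike.norm_conj]
        gcongr
        · exact norm_le_pi_norm _ _
        · exact (norm_le_pi_norm _ _).trans (hF x hx)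
      have e3 : 0 ≤ 2 * (d i).re * ((r x i).re ^ 2 + (r x i).im ^ 2) := by
        have := hd i; positivity
      rw [e1]
      have := (abs_le.1 e2).1
      nlinarith
    have hsum := Finset.sum_le_sum fun i (_ : i ∈ Finset.univ) => hterm i
    rw [Finset.sum_const, Finset.card_univ, Fintype.card_fin] at hsum
    have ha : 0 ≤ C / (1 + x) ^ 2 := by positivity
    have hq : 6 * (‖r x‖ * (‖r x‖ + β)) ≤ 9 * (φ x + β ^ 2 / 3) := by
      nlinarith [hsq x, sq_nonneg (‖r x‖ - β)]
    have hE := Real.exp_pos (-(9 * C / (1 + x)))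
    have hq' := mul_le_mul_of_nonneg_left hq ha
    rw [nsmul_eq_mul] at hsum
    have e9 : 9 * C / (1 + x) ^ 2 = 9 * (C / (1 + x) ^ 2) := by ring
    rw [e9]
    have key : 0 ≤ (∑ i, (2 * (r x i).re * (d i * r x i + F x i).re
        + 2 * (r x i).im * (d i * r x i + F x i).im))
        + (φ x + β ^ 2 / 3) * (9 * (C / (1 + x) ^ 2)) := by
      push_cast at hsum
      nlinarith
    calc (0:ℝ) ≤ ((∑ i, (2 * (r x i).re * (d i * r x i + F x i).re
        + 2 * (r x i).im * (d i * r x i + F x i).im))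
        + (φ x + β ^ 2 / 3) * (9 * (C / (1 + x) ^ 2))) * Real.exp (-(9 * C / (1 + x))) := by
          positivity
      _ = _ := by ring
  have hmono : MonotoneOn ψ (Ici 0) := by
    apply monotoneOn_of_deriv_nonneg (convex_Ici 0)
    · apply (hφcont.add continuousOn_const).mul
      apply Real.continuous_exp.comp_continuousOn
      apply ContinuousOn.neg
      apply ContinuousOn.div continuousOn_const (by fun_prop)
      intro x hx
      have : (0:ℝ) ≤ x := hx
      positivity
    · intro x hx
      rw [interior_Ici] at hx
      obtain ⟨D, -, hD⟩ := hψd x hx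
      exact hD.differentiableAt.differentiableWithinAt
    · intro x hx
      rw [interior_Ici] at hx
      obtain ⟨D, hD0, hD⟩ := hψd x hx
      rwa [hD.deriv]
  have hψlim : Tendsto ψ atTop (𝓝 (β ^ 2 / 3)) := by
    have h1 : Tendsto φ atTop (𝓝 0) := by
      have : ∀ i, Tendsto (fun x => r x i) atTop (𝓝 0) := fun i => (tendsto_pi_nhds.1 hlim) i
      have h2 : Tendsto φ atTop (𝓝 (∑ i : Fin 3, ((0:ℂ).re ^ 2 + (0:ℂ).im ^ 2))) :=
        tendsto_finsetSum _ fun i _ =>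
          (((Complex.continuous_re.tendsto 0).comp (this i)).pow 2).add
            (((Complex.continuous_im.tendsto 0).comp (this i)).pow 2)
      simpa using h2
    have h2 : Tendsto (fun x : ℝ => Real.exp (-(9 * C / (1 + x)))) atTop (𝓝 1) := by
      have h3 : Tendsto (fun x : ℝ => -(9 * C / (1 + x))) atTop (𝓝 (-0)) :=
        (Tendsto.const_div_atTop (tendsto_atTop_add_const_left _ 1 tendsto_id) _).neg
      simpa [Function.comp_def] using (Real.continuous_exp.tendsto _).comp h3
    have h4 := (h1.add_const (β ^ 2 / 3)).mul h2
    simpa using h4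
  have hψ0 : ψ 0 ≤ β ^ 2 / 3 := by
    refine ge_of_tendsto hψlim ?_
    filter_upwards [eventually_ge_atTop (0:ℝ)] with x hx
    exact hmono (mem_Ici.2 le_rfl) hx hx
  have h0 : ‖r 0‖ ^ 2 ≤ (Real.exp (9 * C) * β) ^ 2 := by
    have hE : Real.exp (9 * C) * Real.exp (-(9 * C / (1 + 0))) = 1 := by
      rw [← Real.exp_add]; simp
    have hE1 : 1 ≤ Real.exp (9 * C) := Real.one_le_exp (by positivity)
    have h1 := mul_le_mul_of_nonneg_left hψ0 (Real.exp_pos (9 * C)).le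
    have h2 : Real.exp (9 * C) * ψ 0 = φ 0 + β ^ 2 / 3 := by
      simp only [hψ]
      calc _ = (φ 0 + β ^ 2 / 3) * (Real.exp (9 * C) * Real.exp (-(9 * C / (1 + 0)))) := by ring
        _ = _ := by rw [hE, mul_one]
    rw [h2] at h1
    have h3 := hsq 0
    have h5 : 0 ≤ β ^ 2 := sq_nonneg β
    calc ‖r 0‖ ^ 2 ≤ Real.exp (9 * C) * β ^ 2 := by
          nlinarith [mul_nonneg (Real.exp_pos (9 * C)).le h5]
      _ ≤ (Real.exp (9 * C) * Real.exp (9 * C)) * β ^ 2 := by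
          gcongr
          nlinarith
      _ = _ := by ring
  exact le_of_sq_le_sq h0 (by positivity)

lemma integrableOn_weight (K : ℝ) :
    IntegrableOn (fun x : ℝ => K / (1 + x) ^ 2) (Ioi 0) := by
  have h := integrableOn_add_rpow_Ioi_of_lt (a := -2) (c := 0) (m := 1) (by norm_num) (by norm_num)
  refine IntegrableOn.congr_fun (h.const_mul K) (fun x hx => ?_) measurableSet_Ioi
  have hx' : (0:ℝ) < x := hx
  have h1 : (x + 1) ^ (-2 : ℝ) = ((x + 1) ^ 2)⁻¹ := by
    rw [Real.rpow_neg (by positivity)]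
    norm_cast
  change K * (x + 1) ^ (-2 : ℝ) = K / (1 + x) ^ 2
  rw [h1, add_comm x 1, div_eq_mul_inv]

/-- A solution of the scalar Volterra equation on the half line solves the differential equation,
and has the prescribed limit. -/
lemma volterra_hasDerivAt {a δ : ℂ} (ha : 0 ≤ a.re) {h y : ℝ → ℂ} {K : ℝ}
    (hh : ContinuousOn h (Ici 0)) (hK : ∀ x, 0 ≤ x → ‖h x‖ ≤ K / (1 + x) ^ 2)
    (hy : ∀ x, 0 ≤ x → y x = δ - ∫ x' in Ioi x, Complex.exp (((x : ℂ) - (x' : ℂ)) * a) * h x') :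
    (∀ x, 0 < x → HasDerivAt y (a * (y x - δ) + h x) x) ∧ Tendsto y atTop (𝓝 δ) := by
  have hkc : ContinuousOn (fun x' : ℝ => Complex.exp (-(x' : ℂ) * a) * h x') (Ici 0) := by
    apply ContinuousOn.mul _ hh
    fun_prop
  have hkn : ∀ x' : ℝ, 0 < x' → ‖Complex.exp (-(x' : ℂ) * a) * h x'‖ ≤ K / (1 + x') ^ 2 := by
    intro x' hx'
    rw [norm_mul, Complex.norm_exp]
    calc _ ≤ 1 * ‖h x'‖ := by
          gcongr
          rw [Real.exp_le_one_iff]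
          simp
          positivity
      _ ≤ _ := by rw [one_mul]; exact hK x' hx'.le
  have hki : IntegrableOn (fun x' : ℝ => Complex.exp (-(x' : ℂ) * a) * h x') (Ioi 0) := by
    refine Integrable.mono' (integrableOn_weight K)
      ((hkc.mono Ioi_subset_Ici_self).aestronglyMeasurable measurableSet_Ioi) ?_
    exact (ae_restrict_iff' measurableSet_Ioi).2 (ae_of_all _ hkn)
  have hy2 : ∀ x : ℝ, 0 ≤ x → y x = δ - Complex.exp ((x : ℂ) * a) *
      ((∫ x' in Ioi (0:ℝ), Complex.exp (-(x' : ℂ) * a) * h x')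
        - ∫ x' in (0:ℝ)..x, Complex.exp (-(x' : ℂ) * a) * h x') := by
    intro x hx
    rw [← intervalIntegral.integral_Ioi_sub_Ioi hki hx, sub_sub_cancel, hy x hx,
      ← integral_const_mul]
    congr 2
    ext x'
    rw [← mul_assoc, ← Complex.exp_add]
    ring_nf
  refine ⟨fun x hx => ?_, ?_⟩
  · have hc1 : ContinuousAt (fun x' : ℝ => Complex.exp (-(x' : ℂ) * a) * h x') x :=
      hkc.continuousAt (Ici_mem_nhds hx)
    have hd1 := intervalIntegral.integral_hasDerivAt_right
      ((intervalIntegrable_iff_integrableOn_Ioc_of_le hx.le).2 (hki.mono_set Ioc_subset_Ioi_self))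
      ((hkc.mono Ioi_subset_Ici_self).stronglyMeasurableAtFilter isOpen_Ioi x hx) hc1
    have hd2 : HasDerivAt (fun x : ℝ => Complex.exp ((x : ℂ) * a))
        (Complex.exp ((x : ℂ) * a) * (1 * a)) x :=
      ((Complex.ofRealCLM.hasDerivAt (x := x)).mul_const a).cexp
    have hd3 := ((hd2.fun_mul (hd1.const_sub
      (∫ x' in Ioi (0:ℝ), Complex.exp (-(x' : ℂ) * a) * h x'))).const_sub δ)
    have hd4 := hd3.congr_of_eventuallyEq (f₁ := y) (by
      filter_upwards [Ici_mem_nhds hx] with z hz using hy2 z hz)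
    refine hd4.congr_deriv ?_
    rw [hy2 x hx.le]
    have hE : Complex.exp ((x : ℂ) * a) * Complex.exp (-(x : ℂ) * a) = 1 := by
      rw [← Complex.exp_add]; simp
    linear_combination (h x) * hE
  · have hlim : Tendsto (fun x : ℝ => ∫ x' in Ioi x, K / (1 + x') ^ 2) atTop (𝓝 0) := by
      have h1 := intervalIntegral_tendsto_integral_Ioi 0 (integrableOn_weight K) tendsto_id
      have h2 := h1.const_sub (∫ x' in Ioi (0:ℝ), K / (1 + x') ^ 2)
      rw [sub_self] at h2
      refine h2.congr' ?_
      filter_upwards [eventually_ge_atTop (0:ℝ)] with x hx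
      rw [id, ← intervalIntegral.integral_Ioi_sub_Ioi (integrableOn_weight K) hx, sub_sub_cancel]
    rw [tendsto_iff_norm_sub_tendsto_zero]
    refine squeeze_zero' (Eventually.of_forall fun _ => norm_nonneg _) ?_ hlim
    filter_upwards [eventually_ge_atTop (0:ℝ)] with x hx
    rw [hy x hx, sub_sub_cancel_left, norm_neg]
    refine norm_integral_le_of_norm_le ((integrableOn_weight K).mono_set (Ioi_subset_Ioi hx)) ?_
    refine (ae_restrict_iff' measurableSet_Ioi).2 (ae_of_all _ fun x' hx' => ?_)
    have hx'' : x < x' := hx'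
    rw [norm_mul, Complex.norm_exp]
    calc _ ≤ 1 * ‖h x'‖ := by
          gcongr
          rw [Real.exp_le_one_iff]
          simp
          exact mul_nonpos_of_nonpos_of_nonneg (by linarith) ha
      _ ≤ _ := by rw [one_mul]; exact hK x' (by linarith)

/-- Bounded solutions of the spatial part of a flat connection, normalized at infinity,
satisfy the temporal part at `x = 0`. -/
theorem column_flow {T t : ℝ} (ht : t ∈ Icc 0 T) {d : Fin 3 → ℂ} (hd : ∀ i, 0 ≤ (d i).re)
    {Z : (Fin 3 → ℂ) →L[ℝ] (Fin 3 → ℂ)}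
    {U : ℝ → ℝ → (Fin 3 → ℂ) →L[ℝ] (Fin 3 → ℂ)} {Ut V Vx : ℝ → (Fin 3 → ℂ) →L[ℝ] (Fin 3 → ℂ)}
    {b : Fin 3 → ℂ} {c : ℝ → ℝ → Fin 3 → ℂ} {C K B : ℝ}
    (hcc : ∀ s ∈ Icc 0 T, ContinuousOn (c s) (Ici 0))
    (hcd : ∀ s ∈ Icc 0 T, ∀ x, 0 < x →
      HasDerivAt (c s) (opOf (diagonal d) (c s x) + U s x (c s x)) x)
    (hcl : ∀ s ∈ Icc 0 T, Tendsto (c s) atTop (𝓝 b))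
    (hcb : ∀ x, 0 ≤ x → ‖c t x‖ ≤ K)
    (hZb : Z b = 0)
    (hU : ∀ s ∈ Icc 0 T, ∀ x, 0 ≤ x → ‖U s x‖ ≤ C / (1 + x) ^ 2)
    (hUt : ∀ x, 0 < x → ‖Ut x‖ ≤ C / (1 + x) ^ 2)
    (hUd : ∀ ε > 0, ∃ δ > 0, ∀ s ∈ Icc 0 T, |s - t| < δ → ∀ x, 0 < x →
      ‖U s x - U t x - (s - t) • Ut x‖ ≤ ε * |s - t| / (1 + x) ^ 2)
    (hVc : ContinuousOn V (Ici 0)) (hVd : ∀ x, 0 < x → HasDerivAt V (Vx x) x)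
    (hVl : Tendsto V atTop (𝓝 0)) (hVb : ∀ x, 0 ≤ x → ‖V x‖ ≤ B)
    (hflat : ∀ x, 0 < x → ∀ w, Vx x w + (Z + V x) (opOf (diagonal d) w + U t x w)
      = Ut x w + opOf (diagonal d) ((Z + V x) w) + U t x ((Z + V x) w)) :
    HasDerivWithinAt (fun s => c s 0) (Z (c t 0) + V 0 (c t 0)) (Icc 0 T) t := by
  set D := opOf (diagonal d) with hD
  have hK0 : 0 ≤ K := (norm_nonneg _).trans (hcb 0 le_rfl)
  have hB0 : 0 ≤ B := (norm_nonneg _).trans (hVb 0 le_rfl)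
  have hC0 : 0 ≤ C := by
    have := (norm_nonneg _).trans (hU t ht 0 le_rfl)
    simpa using this
  set g : ℝ → Fin 3 → ℂ := fun x => (Z + V x) (c t x) with hg
  set G : ℝ := (‖Z‖ + B) * K with hG
  have hG0 : 0 ≤ G := by positivity
  have hgb : ∀ x, 0 ≤ x → ‖g x‖ ≤ G := by
    intro x hx
    refine ((Z + V x).le_opNorm _).trans ?_
    have h1 : ‖Z + V x‖ ≤ ‖Z‖ + B := (norm_add_le _ _).trans (by gcongr; exact hVb x hx)
    exact mul_le_mul h1 (hcb x hx) (norm_nonneg _) (by positivity)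
  have hgd : ∀ x, 0 < x → HasDerivAt g (Ut x (c t x) + D (g x) + U t x (g x)) x := by
    intro x hx
    have h := ((hVd x hx).const_add Z).clm_apply (hcd t ht x hx)
    rw [hflat x hx] at h
    exact h
  have hgc : ContinuousOn g (Ici 0) := (continuousOn_const.add hVc).clm_apply (hcc t ht)
  have hgl : Tendsto g atTop (𝓝 0) := by
    have h := (isBoundedBilinearMap_apply (𝕜 := ℝ) (E := Fin 3 → ℂ) (F := Fin 3 → ℂ)).continuous.tendsto
      (Z + 0, b) |>.comp ((hVl.const_add Z).prodMk_nhds (hcl t ht))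
    simpa [hg, hZb, Function.comp_def] using h
  rw [hasDerivWithinAt_iff_isLittleO, Asymptotics.isLittleO_iff]
  intro η hη
  set M := Real.exp (9 * (C + 1)) with hM
  have hM0 : 0 < M := Real.exp_pos _
  set ε := η / (2 * M * (K + 1)) with hε
  have hε0 : 0 < ε := by positivity
  obtain ⟨δ, hδ0, hδ⟩ := hUd ε hε0
  set δ' := η / (2 * M * ((ε + C) * G + 1)) with hδ'
  have hδ'0 : 0 < δ' := by positivity
  filter_upwards [self_mem_nhdsWithin,
    mem_nhdsWithin_of_mem_nhds (Metric.ball_mem_nhds t (lt_min hδ0 hδ'0))] with s hs hst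
  rw [Metric.mem_ball, Real.dist_eq, lt_min_iff] at hst
  set β := |s - t| * (ε * K + (ε + C) * |s - t| * G) with hβ
  have hβ0 : 0 ≤ β := by positivity
  set r : ℝ → Fin 3 → ℂ := fun x => c s x - c t x - (s - t) • g x with hr
  set F : ℝ → Fin 3 → ℂ := fun x => U s x (r x)
    + (U s x - U t x - (s - t) • Ut x) (c t x) + (s - t) • (U s x - U t x) (g x) with hF
  have hest : ‖r 0‖ ≤ M * β := by
    refine energy_estimate hd (F := F) (by positivity) hβ0 ?_ ?_ ?_ ?_
    · exact ((hcc s hs).sub (hcc t ht)).sub (hgc.const_smul (s - t))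
    · intro x hx
      have h := ((hcd s hs x hx).sub (hcd t ht x hx)).sub ((hgd x hx).const_smul (s - t))
      refine h.congr_deriv ?_
      simp only [hr, hF, ← hD, map_sub, map_smul, _root_.sub_apply,
        _root_.smul_apply, smul_add, smul_sub]
      abel
    · intro x hx
      have hw : (0:ℝ) < (1 + x) ^ 2 := by positivity
      have hd0 := hδ s hs hst.1 x hx
      have hΔ : ‖U s x - U t x‖ ≤ (ε + C) * |s - t| / (1 + x) ^ 2 := by
        calc ‖U s x - U t x‖ = ‖(U s x - U t x - (s - t) • Ut x) + (s - t) • Ut x‖ := by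
              rw [sub_add_cancel]
          _ ≤ ε * |s - t| / (1 + x) ^ 2 + |s - t| * (C / (1 + x) ^ 2) := by
              refine (norm_add_le _ _).trans (add_le_add hd0 ?_)
              rw [norm_smul, Real.norm_eq_abs]
              gcongr
              exact hUt x hx
          _ = _ := by ring
      have e1 : ‖U s x (r x)‖ ≤ C / (1 + x) ^ 2 * ‖r x‖ :=
        ((U s x).le_opNorm _).trans (by gcongr; exact hU s hs x hx.le)
      have e2 : ‖(U s x - U t x - (s - t) • Ut x) (c t x)‖ ≤ ε * |s - t| / (1 + x) ^ 2 * K :=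
        (ContinuousLinearMap.le_opNorm _ _).trans (by gcongr; exact hcb x hx.le)
      have e3 : ‖(s - t) • (U s x - U t x) (g x)‖ ≤
          |s - t| * ((ε + C) * |s - t| / (1 + x) ^ 2 * G) := by
        rw [norm_smul, Real.norm_eq_abs]
        gcongr
        exact (ContinuousLinearMap.le_opNorm _ _).trans (by gcongr; exact hgb x hx.le)
      calc ‖F x‖ ≤ C / (1 + x) ^ 2 * ‖r x‖ + ε * |s - t| / (1 + x) ^ 2 * K
            + |s - t| * ((ε + C) * |s - t| / (1 + x) ^ 2 * G) :=
            (norm_add_le _ _).trans (add_le_add ((norm_add_le _ _).trans (add_le_add e1 e2)) e3)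
        _ = (C * ‖r x‖ + β) / (1 + x) ^ 2 := by rw [hβ]; field_simp; ring
        _ ≤ ((C + 1) * (‖r x‖ + β)) / (1 + x) ^ 2 := by
            gcongr
            nlinarith [norm_nonneg (r x), mul_nonneg hC0 hβ0]
        _ = _ := by ring
    · have h := ((hcl s hs).sub (hcl t ht)).sub (hgl.const_smul (s - t))
      simpa using h
  refine hest.trans ?_
  rw [Real.norm_eq_abs]
  have h1 : M * (ε * K) ≤ η / 2 := by
    have : M * (ε * (K + 1)) = η / 2 := by rw [hε]; field_simp
    nlinarith [mul_pos hM0 hε0]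
  have h2 : M * ((ε + C) * |s - t| * G) ≤ η / 2 := by
    have e : M * (((ε + C) * G + 1) * δ') = η / 2 := by rw [hδ']; field_simp
    have e' : (ε + C) * |s - t| * G ≤ ((ε + C) * G + 1) * δ' := by
      have := mul_le_mul_of_nonneg_left hst.2.le (show 0 ≤ (ε + C) * G by positivity)
      nlinarith
    rw [← e]
    gcongr
  calc M * β = |s - t| * (M * (ε * K) + M * ((ε + C) * |s - t| * G)) := by rw [hβ]; ring
    _ ≤ |s - t| * (η / 2 + η / 2) := by gcongr
    _ = η * |s - t| := by ring

/-- The closed half strip `[0,∞) × [0,T]`. -/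
def halfStrip (T : ℝ) : Set (ℝ × ℝ) := Ici 0 ×ˢ Icc 0 T

section HalfStrip

variable {T : ℝ} {w : ℝ → ℝ → ℝ}

lemma uniqueDiffOn_halfStrip (hT : 0 < T) : UniqueDiffOn ℝ (halfStrip T) :=
  (uniqueDiffOn_Ici 0).prod (uniqueDiffOn_Icc hT)

lemma halfStrip_subset_closure_interior (hT : 0 < T) :
    halfStrip T ⊆ closure (interior (halfStrip T)) := by
  rw [halfStrip, interior_prod_eq, closure_prod_eq, interior_Ici, interior_Icc, closure_Ioi,
    closure_Ioo hT.ne]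

lemma hasDerivWithinAt_fst {f : ℝ × ℝ → ℝ} {f' : ℝ × ℝ →L[ℝ] ℝ} {x t : ℝ}
    (h : HasFDerivWithinAt f f' (halfStrip T) (x, t)) (ht : t ∈ Icc 0 T) :
    HasDerivWithinAt (fun y => f (y, t)) (f' (1, 0)) (Ici 0) x :=
  h.comp_hasDerivWithinAt x ((hasDerivWithinAt_id x _).prodMk (hasDerivWithinAt_const x _ t))
    fun _ hy => mk_mem_prod hy ht

lemma hasDerivWithinAt_snd {f : ℝ × ℝ → ℝ} {f' : ℝ × ℝ →L[ℝ] ℝ} {x t : ℝ}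
    (h : HasFDerivWithinAt f f' (halfStrip T) (x, t)) (hx : x ∈ Ici (0:ℝ)) :
    HasDerivWithinAt (fun s => f (x, s)) (f' (0, 1)) (Icc 0 T) t :=
  h.comp_hasDerivWithinAt t ((hasDerivWithinAt_const t _ x).prodMk (hasDerivWithinAt_id t _))
    fun _ hs => mk_mem_prod hx hs

lemma hasFDerivWithinAt_halfStrip {f : ℝ × ℝ → ℝ}
    (hf : ContDiffOn ℝ (⊤ : ℕ∞) f (halfStrip T)) {p : ℝ × ℝ} (hp : p ∈ halfStrip T) :
    HasFDerivWithinAt f (fderivWithin ℝ f (halfStrip T) p) (halfStrip T) p :=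
  (hf.differentiableOn (by simp) p hp).hasFDerivWithinAt

lemma contDiffOn_fderivWithin_halfStrip (hT : 0 < T) {f : ℝ × ℝ → ℝ}
    (hf : ContDiffOn ℝ (⊤ : ℕ∞) f (halfStrip T)) :
    ContDiffOn ℝ (⊤ : ℕ∞) (fderivWithin ℝ f (halfStrip T)) (halfStrip T) :=
  hf.fderivWithin (uniqueDiffOn_halfStrip hT) (by norm_cast)

lemma dxn_succ_eq {n : ℕ}
    (hw : ContDiffOn ℝ (⊤ : ℕ∞) (fun p : ℝ × ℝ => dxn n w p.2 p.1) (halfStrip T))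
    {x t : ℝ} (hx : x ∈ Ici (0:ℝ)) (ht : t ∈ Icc 0 T) :
    dxn (n + 1) w t x =
      fderivWithin ℝ (fun p : ℝ × ℝ => dxn n w p.2 p.1) (halfStrip T) (x, t) (1, 0) := by
  have h := hasDerivWithinAt_fst (hasFDerivWithinAt_halfStrip hw ⟨hx, ht⟩) ht
  have h2 := h.derivWithin (uniqueDiffOn_Ici 0 x hx)
  rw [← h2, dxn, iteratedDerivWithin_succ]
  rfl

lemma contDiffOn_dxn (hT : 0 < T)
    (hw : ContDiffOn ℝ (⊤ : ℕ∞) (fun p : ℝ × ℝ => w p.1 p.2) (halfStrip T)) (n : ℕ) :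
    ContDiffOn ℝ (⊤ : ℕ∞) (fun p : ℝ × ℝ => dxn n w p.2 p.1) (halfStrip T) := by
  induction n with
  | zero => simpa [dxn] using hw
  | succ n ih =>
    refine ((contDiffOn_fderivWithin_halfStrip hT ih).clm_apply
      (contDiffOn_const (c := ((1:ℝ), (0:ℝ))))).congr ?_
    rintro ⟨x, t⟩ ⟨hx, ht⟩
    exact dxn_succ_eq ih hx ht

lemma hasDerivWithinAt_dxn (hT : 0 < T)
    (hw : ContDiffOn ℝ (⊤ : ℕ∞) (fun p : ℝ × ℝ => w p.1 p.2) (halfStrip T)) (n : ℕ)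
    {x t : ℝ} (hx : x ∈ Ici (0:ℝ)) (ht : t ∈ Icc 0 T) :
    HasDerivWithinAt (dxn n w t) (dxn (n + 1) w t x) (Ici 0) x := by
  rw [dxn_succ_eq (contDiffOn_dxn hT hw n) hx ht]
  exact hasDerivWithinAt_fst (hasFDerivWithinAt_halfStrip (contDiffOn_dxn hT hw n) ⟨hx, ht⟩) ht

lemma hasDerivWithinAt_dt1
    (hw : ContDiffOn ℝ (⊤ : ℕ∞) (fun p : ℝ × ℝ => w p.1 p.2) (halfStrip T))
    {x t : ℝ} (hx : x ∈ Ici (0:ℝ)) (ht : t ∈ Icc 0 T) :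
    HasDerivWithinAt (fun s => w x s) (dt1 T w x t) (Icc 0 T) t :=
  (hasDerivWithinAt_snd (hasFDerivWithinAt_halfStrip hw ⟨hx, ht⟩)
    hx).differentiableWithinAt.hasDerivWithinAt

/-- Mixed partial derivatives commute up to the boundary of the half strip. -/
lemma hasDerivWithinAt_dt_dxn_one (hT : 0 < T)
    (hw : ContDiffOn ℝ (⊤ : ℕ∞) (fun p : ℝ × ℝ => w p.1 p.2) (halfStrip T))
    {x t : ℝ} (hx : x ∈ Ici (0:ℝ)) (ht : t ∈ Icc 0 T) :
    HasDerivWithinAt (fun s => dxn 1 w s x)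
      (derivWithin (fun y => dt1 T w y t) (Ici 0) x) (Icc 0 T) t := by
  set F := fderivWithin ℝ (fun p : ℝ × ℝ => w p.1 p.2) (halfStrip T) with hF
  have hFs : ContDiffOn ℝ (⊤ : ℕ∞) F (halfStrip T) := contDiffOn_fderivWithin_halfStrip hT hw
  have hFd : HasFDerivWithinAt F (fderivWithin ℝ F (halfStrip T) (x, t)) (halfStrip T) (x, t) :=
    (hFs.differentiableOn (by simp) _ ⟨hx, ht⟩).hasFDerivWithinAt
  have hd1 := hasDerivWithinAt_snd (hFd.clm_apply (hasFDerivWithinAt_const ((1:ℝ), (0:ℝ)) _ _)) hx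
  have hd2 := hasDerivWithinAt_fst (hFd.clm_apply (hasFDerivWithinAt_const ((0:ℝ), (1:ℝ)) _ _)) ht
  have hsymm : IsSymmSndFDerivWithinAt ℝ (fun p : ℝ × ℝ => w p.1 p.2) (halfStrip T) (x, t) :=
    (hw _ ⟨hx, ht⟩).isSymmSndFDerivWithinAt (by
      rw [minSmoothness_of_isRCLikeNormedField]
      exact WithTop.coe_le_coe.2 (le_top : (2 : ℕ∞) ≤ ⊤)) (uniqueDiffOn_halfStrip hT)
      (halfStrip_subset_closure_interior hT ⟨hx, ht⟩) ⟨hx, ht⟩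
  have e1 : ∀ s ∈ Icc 0 T, dxn 1 w s x = F (x, s) (1, 0) := by
    intro s hs
    have h0 := contDiffOn_dxn hT hw 0
    have h1 := dxn_succ_eq h0 hx hs
    simpa [dxn] using h1
  have e2 : ∀ y ∈ Ici (0:ℝ), dt1 T w y t = F (y, t) (0, 1) := fun y hy =>
    (hasDerivWithinAt_snd (hasFDerivWithinAt_halfStrip hw ⟨hy, ht⟩)
      hy).derivWithin (uniqueDiffOn_Icc hT t ht)
  rw [derivWithin_congr e2 (e2 x hx), hd2.derivWithin (uniqueDiffOn_Ici 0 x hx)]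
  refine (hd1.congr e1 (e1 t ht)).congr_deriv ?_
  simpa using hsymm (0, 1) (1, 0)

/-- First-order Taylor estimate in time, uniform in `x` with an algebraic weight. -/
lemma uniform_taylor {f f' : ℝ → ℝ → ℝ} {C : ℝ}
    (hf : ∀ x ∈ Ici (0:ℝ), ∀ s ∈ Icc 0 T, HasDerivWithinAt (fun r => f r x) (f' s x) (Icc 0 T) s)
    (hc : ContinuousOn (fun p : ℝ × ℝ => f' p.2 p.1) (halfStrip T))
    (hb : ∀ x ∈ Ici (0:ℝ), ∀ s ∈ Icc 0 T, |f' s x| ≤ C / (1 + x) ^ 3)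
    {t : ℝ} (ht : t ∈ Icc 0 T) {ε : ℝ} (hε : 0 < ε) :
    ∃ δ > 0, ∀ s ∈ Icc 0 T, |s - t| < δ → ∀ x ∈ Ici (0:ℝ),
      |f s x - f t x - (s - t) * f' t x| ≤ ε * |s - t| / (1 + x) ^ 2 := by
  have hC0 : 0 ≤ C := by
    have := (abs_nonneg _).trans (hb 0 (mem_Ici.2 le_rfl) t ht)
    simpa using this
  have hosc : ∃ δ > 0, ∀ s ∈ Icc 0 T, |s - t| < δ → ∀ x ∈ Ici (0:ℝ),
      |f' s x - f' t x| ≤ ε / (1 + x) ^ 2 := by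
    set X := 2 * C / ε with hX
    have hX0 : 0 ≤ X := by positivity
    have hcomp : IsCompact (Icc 0 X ×ˢ Icc 0 T) := isCompact_Icc.prod isCompact_Icc
    have hsub : Icc 0 X ×ˢ Icc 0 T ⊆ halfStrip T := prod_mono Icc_subset_Ici_self subset_rfl
    have huc := hcomp.uniformContinuousOn_of_continuous (hc.mono hsub)
    rw [Metric.uniformContinuousOn_iff] at huc
    obtain ⟨δ, hδ0, hδ⟩ := huc (ε / (1 + X) ^ 2) (by positivity)
    refine ⟨δ, hδ0, fun s hs hst x hx => ?_⟩
    have hx0 : (0:ℝ) ≤ x := hx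
    by_cases hxX : x ≤ X
    · have h := hδ (x, s) ⟨⟨hx0, hxX⟩, hs⟩ (x, t) ⟨⟨hx0, hxX⟩, ht⟩ (by
        simpa [Prod.dist_eq, Real.dist_eq] using hst)
      rw [Real.dist_eq] at h
      refine h.le.trans ?_
      gcongr
    · push Not at hxX
      have h1 : C / (1 + x) ^ 3 ≤ ε / 2 / (1 + x) ^ 2 := by
        rw [div_le_div_iff₀ (by positivity) (by positivity)]
        have h3 : C ≤ ε / 2 * (1 + x) := by
          have h4 : ε / 2 * X = C := by rw [hX]; field_simp
          nlinarith
        calc C * (1 + x) ^ 2 ≤ (ε / 2 * (1 + x)) * (1 + x) ^ 2 := by gcongr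
          _ = _ := by ring
      calc |f' s x - f' t x| ≤ |f' s x| + |f' t x| := abs_sub _ _
        _ ≤ ε / 2 / (1 + x) ^ 2 + ε / 2 / (1 + x) ^ 2 :=
            add_le_add ((hb x hx s hs).trans h1) ((hb x hx t ht).trans h1)
        _ = _ := by ring
  obtain ⟨δ, hδ0, hδ⟩ := hosc
  refine ⟨δ, hδ0, fun s hs hst x hx => ?_⟩
  have hseg : uIcc t s ⊆ Icc 0 T := uIcc_subset_Icc ht hs
  have h := Convex.norm_image_sub_le_of_norm_hasDerivWithin_le
    (f := fun r => f r x - r * f' t x) (f' := fun r => f' r x - 1 * f' t x) (s := uIcc t s)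
    (x := t) (y := s) (C := ε / (1 + x) ^ 2)
    (fun r hr => ((hf x hx r (hseg hr)).mono hseg).fun_sub
      ((hasDerivWithinAt_id r _).mul_const _))
    (fun r hr => by
      rw [one_mul, Real.norm_eq_abs]
      exact hδ r (hseg hr) ((abs_sub_left_of_mem_uIcc hr).trans_lt hst) x hx)
    (convex_uIcc t s) left_mem_uIcc right_mem_uIcc
  rw [Real.norm_eq_abs, Real.norm_eq_abs] at h
  calc _ = |f s x - s * f' t x - (f t x - t * f' t x)| := by congr 1; ring
    _ ≤ _ := h
    _ = _ := by ring

end HalfStrip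

/-- Spatial Lax matrix with `a = u`, `a₁ = u_x`, `b = v`. -/
def Elax (a a₁ b : ℝ) : Matrix (Fin 3) (Fin 3) ℂ :=
  !![0, 0, 0; 0, 0, 0;
     -(a₁ : ℂ) / 4 - Complex.I * (b : ℂ) / (4 * (Real.sqrt 3 : ℂ)), -(a : ℂ) / 2, 0]

/-- Temporal Lax matrix with `a = u`, `a₁ = u_x`, `a₂ = u_xx`, `b = v`, `b₁ = v_x`. -/
def Nlax (a a₁ a₂ b b₁ : ℝ) : Matrix (Fin 3) (Fin 3) ℂ :=
  !![-Complex.I * (a : ℂ) / (Real.sqrt 3 : ℂ), 0, 0;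
     -Complex.I * (a₁ : ℂ) / (4 * (Real.sqrt 3 : ℂ)) - (b : ℂ) / 4,
       Complex.I * (a : ℂ) / (2 * (Real.sqrt 3 : ℂ)), 0;
     -Complex.I * (a₂ : ℂ) / (4 * (Real.sqrt 3 : ℂ)) - (b₁ : ℂ) / 4,
       Complex.I * (a₁ : ℂ) / (4 * (Real.sqrt 3 : ℂ)) - (b : ℂ) / 4,
       Complex.I * (a : ℂ) / (2 * (Real.sqrt 3 : ℂ))]

lemma Elax_eq (a a₁ b : ℝ) :
    Elax a a₁ b = (a : ℂ) • Elax 1 0 0 + (a₁ : ℂ) • Elax 0 1 0 + (b : ℂ) • Elax 0 0 1 := by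
  ext i j
  fin_cases i <;> fin_cases j <;> simp [Elax] <;> ring

lemma Nlax_eq (a a₁ a₂ b b₁ : ℝ) :
    Nlax a a₁ a₂ b b₁ = (a : ℂ) • Nlax 1 0 0 0 0 + (a₁ : ℂ) • Nlax 0 1 0 0 0
      + (a₂ : ℂ) • Nlax 0 0 1 0 0 + (b : ℂ) • Nlax 0 0 0 1 0 + (b₁ : ℂ) • Nlax 0 0 0 0 1 := by
  ext i j
  fin_cases i <;> fin_cases j <;> simp [Nlax] <;> ring

/-- The companion matrix of `l³ + l/4 - lam`. -/
def Lhat (lam : ℂ) : Matrix (Fin 3) (Fin 3) ℂ := !![0, 1, 0; 0, 0, 1; lam, -1 / 4, 0]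

/-- The free temporal Lax matrix. -/
def Zhat (lam : ℂ) : Matrix (Fin 3) (Fin 3) ℂ :=
  (-Complex.I * (Real.sqrt 3 : ℂ)) • (Lhat lam * Lhat lam)
    - (Complex.I * (Real.sqrt 3 : ℂ) / 6) • 1

lemma sqrt_three_sq : (Real.sqrt 3 : ℂ) ^ 2 = 3 := by
  rw [← Complex.ofReal_pow, Real.sq_sqrt (by norm_num)]
  norm_num

lemma sqrt_three_ne_zero : (Real.sqrt 3 : ℂ) ≠ 0 := by
  intro h
  have := sqrt_three_sq
  rw [h] at this
  norm_num at this

/-- The zero curvature condition of the Lax pair of the Boussinesq system. -/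
lemma lax_flat (lam : ℂ) (a a₁ a₂ a₃ b b₁ b₂ : ℝ) :
    Nlax a₁ a₂ a₃ b₁ b₂ + (Zhat lam + Nlax a a₁ a₂ b b₁) * (Lhat lam + Elax a a₁ b)
      = Elax b₁ b₂ (a₁ + 2 * a * a₁ + a₃)
        + (Lhat lam + Elax a a₁ b) * (Zhat lam + Nlax a a₁ a₂ b b₁) := by
  have hs := sqrt_three_sq
  have hI := Complex.I_sq
  have hs0 := sqrt_three_ne_zero
  have hinv : (Real.sqrt 3 : ℂ)⁻¹ = (Real.sqrt 3 : ℂ) / 3 := by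
    field_simp
    rw [hs]
  simp only [Nlax, Elax, Zhat, Lhat, div_eq_mul_inv, mul_inv, hinv]
  generalize (Real.sqrt 3 : ℂ) = s at *
  ext i j
  simp only [Matrix.add_apply, Matrix.sub_apply, Matrix.smul_apply, Matrix.mul_apply,
    Fin.sum_univ_three]
  fin_cases i <;> fin_cases j <;>
    simp [Matrix.one_apply] <;> ring_nf <;>
    (try simp only [hs, hI]) <;> (try ring_nf)

/-- The spectral parameter of the companion matrix. -/
def lamOf (k : ℂ) : ℂ := -Complex.I * (k ^ 3 + (k ^ 3)⁻¹) / (24 * (Real.sqrt 3 : ℂ))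

lemma omega_pow_three : ω ^ 3 = 1 := by
  rw [ω, ← Complex.exp_nat_mul]
  convert Complex.exp_two_pi_mul_I using 2
  push_cast
  ring

lemma omega_pow_mul_cube (n : ℕ) (k : ℂ) : (ω ^ n * k) ^ 3 = k ^ 3 := by
  rw [mul_pow, ← pow_mul, mul_comm n 3, pow_mul, omega_pow_three, one_pow, one_mul]

lemma omega_ne_zero : ω ≠ 0 := Complex.exp_ne_zero _

lemma lf_cube (j : Fin 3) {k : ℂ} (hk : k ≠ 0) :
    lf j k ^ 3 = lamOf k - lf j k / 4 := by
  have h3 := omega_pow_mul_cube (j.val + 1) k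
  have hκ : ω ^ (j.val + 1) * k ≠ 0 := mul_ne_zero (pow_ne_zero _ omega_ne_zero) hk
  rw [lf, lamOf, ← h3]
  generalize ω ^ (j.val + 1) * k = κ at hκ
  have hs0 := sqrt_three_ne_zero
  have hs := sqrt_three_sq
  have hI := Complex.I_sq
  have hI3 : Complex.I ^ 3 = -Complex.I := Complex.I_pow_three
  have hs3 : (Real.sqrt 3 : ℂ) ^ 3 = 3 * (Real.sqrt 3 : ℂ) := by rw [pow_succ, hs]
  rw [div_pow, mul_pow, mul_pow, hI3, hs3]
  generalize (Real.sqrt 3 : ℂ) = s at *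
  field_simp
  ring

lemma zf_eq (j : Fin 3) {k : ℂ} (hk : k ≠ 0) :
    zf j k = -Complex.I * (Real.sqrt 3 : ℂ) * lf j k ^ 2 - Complex.I * (Real.sqrt 3 : ℂ) / 6 := by
  have hκ : ω ^ (j.val + 1) * k ≠ 0 := mul_ne_zero (pow_ne_zero _ omega_ne_zero) hk
  rw [lf, zf]
  generalize ω ^ (j.val + 1) * k = κ at hκ
  have hs0 := sqrt_three_ne_zero
  have hs := sqrt_three_sq
  have hI := Complex.I_sq
  rw [div_pow, mul_pow, mul_pow, hI, hs]
  generalize (Real.sqrt 3 : ℂ) = s at *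
  field_simp
  rw [hs]
  ring

lemma Pmat_mul_diagonal_lf {k : ℂ} (hk : k ≠ 0) :
    Pmat k * diagonal (fun i => lf i k) = Lhat (lamOf k) * Pmat k := by
  ext i j
  have h := lf_cube j hk
  rw [Matrix.mul_diagonal]
  fin_cases i
  · simp [Pmat, Lhat, Matrix.mul_apply, Fin.sum_univ_three]
  · simp [Pmat, Lhat, Matrix.mul_apply, Fin.sum_univ_three]
    ring
  · simp [Pmat, Lhat, Matrix.mul_apply, Fin.sum_univ_three]
    linear_combination h

lemma Pmat_mul_diagonal_zf {k : ℂ} (hk : k ≠ 0) :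
    Pmat k * diagonal (fun i => zf i k) = Zhat (lamOf k) * Pmat k := by
  have h1 : diagonal (fun i => zf i k) = (-Complex.I * (Real.sqrt 3 : ℂ)) •
      (diagonal (fun i => lf i k) * diagonal (fun i => lf i k))
        - (Complex.I * (Real.sqrt 3 : ℂ) / 6) • 1 := by
    rw [Matrix.diagonal_mul_diagonal, ← Matrix.diagonal_one, ← Matrix.diagonal_smul,
      ← Matrix.diagonal_smul, Matrix.diagonal_sub]
    congr 1
    ext i
    simp [zf_eq i hk]
    ring
  rw [h1, Zhat, mul_sub, sub_mul, Matrix.mul_smul, Matrix.mul_smul, Matrix.smul_mul,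
    Matrix.smul_mul, ← mul_assoc, Pmat_mul_diagonal_lf hk, mul_assoc, Pmat_mul_diagonal_lf hk,
    mul_assoc, mul_one, one_mul]

lemma lf_injective {k : ℂ} (hk : k ∉ Qhat) : Function.Injective fun j : Fin 3 => lf j k := by
  have hk0 : k ≠ 0 := fun h => hk (by simp [Qhat, h])
  have hk6 : k ^ 6 ≠ 1 := fun h => hk (by simp [Qhat, Qset, h])
  have hω : ω ≠ 1 := by
    intro h
    have h1 := congrArg Complex.re h
    rw [ω, show (2 * Real.pi * Complex.I / 3 : ℂ) = ((2 * Real.pi / 3 : ℝ) : ℂ) * Complex.I by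
      push_cast; ring, Complex.exp_ofReal_mul_I_re] at h1
    have : Real.cos (2 * Real.pi / 3) < 1 := by
      rw [← Real.cos_zero]
      exact Real.cos_lt_cos_of_nonneg_of_le_pi le_rfl (by linarith [Real.pi_pos])
        (by linarith [Real.pi_pos])
    rw [h1] at this
    simp at this
  have hω2 : ω ^ 2 ≠ 1 := fun h => hω (by
    have := omega_pow_three
    rwa [pow_succ, h, one_mul] at this)
  intro a b hab
  by_contra hne
  have hs0 := sqrt_three_ne_zero
  have hκa : ω ^ (a.val + 1) * k ≠ 0 := mul_ne_zero (pow_ne_zero _ omega_ne_zero) hk0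
  have hκb : ω ^ (b.val + 1) * k ≠ 0 := mul_ne_zero (pow_ne_zero _ omega_ne_zero) hk0
  have h1 : ω ^ (a.val + 1) * k + (ω ^ (a.val + 1) * k)⁻¹
      = ω ^ (b.val + 1) * k + (ω ^ (b.val + 1) * k)⁻¹ := by
    simp only [lf] at hab
    rw [div_left_inj' (mul_ne_zero two_ne_zero hs0)] at hab
    exact mul_left_cancel₀ Complex.I_ne_zero hab
  have h2 : (ω ^ (a.val + 1) * k - ω ^ (b.val + 1) * k)
      * ((ω ^ (a.val + 1) * k) * (ω ^ (b.val + 1) * k) - 1) = 0 := by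
    generalize ω ^ (a.val + 1) * k = p at *
    generalize ω ^ (b.val + 1) * k = q at *
    field_simp at h1
    linear_combination h1
  rcases mul_eq_zero.1 h2 with h | h
  · have h3 : ω ^ (a.val + 1) = ω ^ (b.val + 1) := mul_right_cancel₀ hk0 (sub_eq_zero.1 h)
    have h4 := omega_pow_three
    have h12 : ω ^ 1 ≠ ω ^ 2 := fun h => hω (mul_left_cancel₀ omega_ne_zero (by
      linear_combination -h))
    have h13 : ω ^ 1 ≠ ω ^ 3 := by rwa [h4, pow_one]
    have h23 : ω ^ 2 ≠ ω ^ 3 := by rwa [h4]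
    fin_cases a <;> fin_cases b
    · exact hne rfl
    · exact h12 h3
    · exact h13 h3
    · exact h12 h3.symm
    · exact hne rfl
    · exact h23 h3
    · exact h13 h3.symm
    · exact h23 h3.symm
    · exact hne rfl
  · apply hk6
    have h3 : (ω ^ (a.val + 1) * k) ^ 3 * (ω ^ (b.val + 1) * k) ^ 3 = 1 := by
      rw [← mul_pow, sub_eq_zero.1 h, one_pow]
    rw [omega_pow_mul_cube, omega_pow_mul_cube] at h3
    rw [← h3]
    ring

lemma isUnit_det_Pmat {k : ℂ} (hk : k ∉ Qhat) : IsUnit (Pmat k).det := by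
  have h : Pmat k = (Matrix.vandermonde fun j : Fin 3 => lf j k)ᵀ := by
    ext i j
    simp [Pmat, Matrix.vandermonde_apply]
  rw [h, Matrix.det_transpose, isUnit_iff_ne_zero, Matrix.det_vandermonde_ne_zero_iff]
  exact lf_injective hk

/-- The zero curvature condition in the diagonalizing frame. -/
lemma lax_flat_conj {k : ℂ} (hk : k ∉ Qhat) (a a₁ a₂ a₃ b b₁ b₂ : ℝ) (j : Fin 3)
    (w : Fin 3 → ℂ) :
    opOf ((Pmat k)⁻¹ * Nlax a₁ a₂ a₃ b₁ b₂ * Pmat k) w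
      + (opOf (diagonal fun i => zf i k - zf j k)
          + opOf ((Pmat k)⁻¹ * Nlax a a₁ a₂ b b₁ * Pmat k))
        (opOf (diagonal fun i => lf i k - lf j k) w + opOf ((Pmat k)⁻¹ * Elax a a₁ b * Pmat k) w)
      = opOf ((Pmat k)⁻¹ * Elax b₁ b₂ (a₁ + 2 * a * a₁ + a₃) * Pmat k) w
        + opOf (diagonal fun i => lf i k - lf j k)
          ((opOf (diagonal fun i => zf i k - zf j k)
            + opOf ((Pmat k)⁻¹ * Nlax a a₁ a₂ b b₁ * Pmat k)) w)
        + opOf ((Pmat k)⁻¹ * Elax a a₁ b * Pmat k)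
          ((opOf (diagonal fun i => zf i k - zf j k)
            + opOf ((Pmat k)⁻¹ * Nlax a a₁ a₂ b b₁ * Pmat k)) w) := by
  have hk0 : k ≠ 0 := fun h => hk (by simp [Qhat, h])
  have hP := isUnit_det_Pmat hk
  have hl : (diagonal fun i => lf i k - lf j k)
      = (Pmat k)⁻¹ * Lhat (lamOf k) * Pmat k - lf j k • 1 := by
    rw [mul_assoc, ← Pmat_mul_diagonal_lf hk0, Matrix.nonsing_inv_mul_cancel_left _ _ hP,
      ← Matrix.diagonal_one, ← Matrix.diagonal_smul, Matrix.diagonal_sub]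
    simp
  have hz : (diagonal fun i => zf i k - zf j k)
      = (Pmat k)⁻¹ * Zhat (lamOf k) * Pmat k - zf j k • 1 := by
    rw [mul_assoc, ← Pmat_mul_diagonal_zf hk0, Matrix.nonsing_inv_mul_cancel_left _ _ hP,
      ← Matrix.diagonal_one, ← Matrix.diagonal_smul, Matrix.diagonal_sub]
    simp
  have key := congrArg (fun M => (Pmat k)⁻¹ * M * Pmat k)
    (lax_flat (lamOf k) a a₁ a₂ a₃ b b₁ b₂)
  have hconj : ∀ A B : Matrix (Fin 3) (Fin 3) ℂ, (Pmat k)⁻¹ * (A * B) * Pmat k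
      = ((Pmat k)⁻¹ * A * Pmat k) * ((Pmat k)⁻¹ * B * Pmat k) := by
    intro A B
    calc _ = (Pmat k)⁻¹ * A * (Pmat k * (Pmat k)⁻¹) * B * Pmat k := by
          rw [Matrix.mul_nonsing_inv _ hP]; simp only [mul_assoc, one_mul]
      _ = _ := by simp only [mul_assoc]
  simp only [mul_add, add_mul, hconj] at key
  simp only [← mul_add, ← add_mul] at key
  simp only [← opOf_add, opOf_apply, Matrix.mulVec_mulVec, ← Matrix.add_mulVec]
  congr 1
  rw [hl, hz]
  simp only [mul_add, add_mul, mul_sub, sub_mul, Matrix.smul_mul, Matrix.mul_smul, mul_one,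
    one_mul, smul_smul] at key ⊢
  rw [← sub_eq_zero] at key ⊢
  rw [← key, mul_comm (zf j k) (lf j k)]
  abel

lemma re_lf_eq_zero_of_norm {w : ℂ} (hw : ‖w‖ = 1) (m : Fin 3) : (lf m w).re = 0 := by
  have hω : ‖ω‖ = 1 := by
    have h := congrArg norm omega_pow_three
    rw [norm_pow, norm_one] at h
    exact (pow_eq_one_iff_of_nonneg (norm_nonneg _) (by norm_num)).1 h
  have hκ : ‖ω ^ (m.val + 1) * w‖ = 1 := by rw [norm_mul, norm_pow, hω, hw]; simp
  rw [lf]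
  generalize ω ^ (m.val + 1) * w = κ at hκ
  rw [Complex.inv_eq_conj hκ, Complex.add_conj, show (2 * (Real.sqrt 3 : ℂ)) =
    ((2 * Real.sqrt 3 : ℝ) : ℂ) by push_cast; rfl, Complex.div_ofReal_re]
  simp

lemma continuousAt_lf (m : Fin 3) {w : ℂ} (hw : w ≠ 0) : ContinuousAt (lf m) w := by
  have hκ : ω ^ (m.val + 1) * w ≠ 0 := mul_ne_zero (pow_ne_zero _ omega_ne_zero) hw
  have h1 : ContinuousAt (fun k : ℂ => ω ^ (m.val + 1) * k) w := by fun_prop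
  exact (continuousAt_const.mul (h1.add (h1.inv₀ hκ))).div_const _

lemma re_lf_two_le {w : ℂ} (hw : w ∈ S3hat) (hw0 : w ≠ 0) (m : Fin 3) :
    (lf 2 w).re ≤ (lf m w).re := by
  rcases hw with hw | hw
  · have h1 : ‖w‖ = 1 := by simpa using hw
    rw [re_lf_eq_zero_of_norm h1, re_lf_eq_zero_of_norm h1]
  · have := mem_closure_iff_nhdsWithin_neBot.1 hw
    have hc : ∀ i : Fin 3, Tendsto (fun k => (lf i k).re) (𝓝[S3] w) (𝓝 (lf i w).re) := fun i =>
      (Complex.continuous_re.continuousAt.comp (continuousAt_lf i hw0)).mono_left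
        nhdsWithin_le_nhds
    refine le_of_tendsto_of_tendsto (hc 2) (hc m) ?_
    filter_upwards [self_mem_nhdsWithin] with k hk
    fin_cases m
    · exact hk.2.1.le
    · exact hk.2.2.le
    · exact le_rfl

lemma re_lf_le_of_mem_domS3 {j : Fin 3} {k : ℂ} (hk : k ∈ domS3 j \ Qhat) (i : Fin 3) :
    (lf j k).re ≤ (lf i k).re := by
  obtain ⟨⟨w, hw, rfl⟩, hkQ⟩ := hk
  have hw0 : w ≠ 0 := by
    rintro rfl
    exact hkQ (by simp [Qhat])
  have hshift : ∀ a m : Fin 3, ω ^ (a.val + 1 + (2 - j.val)) = ω ^ (m.val + 1) →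
      lf a (ω ^ (2 - j.val) * w) = lf m w := by
    intro a m h
    rw [lf, lf, ← mul_assoc, ← pow_add, h]
  have hj : lf j (ω ^ (2 - j.val) * w) = lf 2 w := hshift j 2 (by
    congr 1
    simp only [Fin.val_two]
    omega)
  obtain ⟨m, hm⟩ : ∃ m : Fin 3, ω ^ (i.val + 1 + (2 - j.val)) = ω ^ (m.val + 1) := by
    refine ⟨⟨(i.val + (2 - j.val)) % 3, Nat.mod_lt _ (by norm_num)⟩, ?_⟩
    have h := Nat.div_add_mod (i.val + (2 - j.val)) 3
    rw [show i.val + 1 + (2 - j.val) = 3 * ((i.val + (2 - j.val)) / 3)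
      + ((i.val + (2 - j.val)) % 3 + 1) by omega, pow_add, pow_mul, omega_pow_three, one_pow,
      one_mul]
  rw [hj, hshift i m hm]
  exact re_lf_two_le hw hw0 m

/-- Conjugation by `P(k)`, as an operator on `Fin 3 → ℂ`. -/
def conjOp (k : ℂ) (M : Matrix (Fin 3) (Fin 3) ℂ) : (Fin 3 → ℂ) →L[ℝ] (Fin 3 → ℂ) :=
  opOf ((Pmat k)⁻¹ * M * Pmat k)

lemma conjOp_add (k : ℂ) (M N : Matrix (Fin 3) (Fin 3) ℂ) :
    conjOp k (M + N) = conjOp k M + conjOp k N := by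
  rw [conjOp, mul_add, add_mul, opOf_add, conjOp, conjOp]

lemma conjOp_smul (k : ℂ) (a : ℝ) (M : Matrix (Fin 3) (Fin 3) ℂ) :
    conjOp k ((a : ℂ) • M) = a • conjOp k M := by
  rw [conjOp, Matrix.mul_smul, Matrix.smul_mul, opOf_smul, conjOp]

lemma conjOp_Elax (k : ℂ) (a a₁ b : ℝ) : conjOp k (Elax a a₁ b) =
    a • conjOp k (Elax 1 0 0) + a₁ • conjOp k (Elax 0 1 0) + b • conjOp k (Elax 0 0 1) := by
  rw [Elax_eq, conjOp_add, conjOp_add, conjOp_smul, conjOp_smul, conjOp_smul]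

lemma conjOp_Nlax (k : ℂ) (a a₁ a₂ b b₁ : ℝ) : conjOp k (Nlax a a₁ a₂ b b₁) =
    a • conjOp k (Nlax 1 0 0 0 0) + a₁ • conjOp k (Nlax 0 1 0 0 0)
      + a₂ • conjOp k (Nlax 0 0 1 0 0) + b • conjOp k (Nlax 0 0 0 1 0)
      + b₁ • conjOp k (Nlax 0 0 0 0 1) := by
  rw [Nlax_eq, conjOp_add, conjOp_add, conjOp_add, conjOp_add, conjOp_smul, conjOp_smul,
    conjOp_smul, conjOp_smul, conjOp_smul]

lemma exists_norm_conjOp_Elax_le (k : ℂ) : ∃ A, 0 ≤ A ∧ ∀ a a₁ b m : ℝ, |a| ≤ m → |a₁| ≤ m →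
    |b| ≤ m → ‖conjOp k (Elax a a₁ b)‖ ≤ A * m := by
  refine ⟨‖conjOp k (Elax 1 0 0)‖ + ‖conjOp k (Elax 0 1 0)‖ + ‖conjOp k (Elax 0 0 1)‖,
    by positivity, fun a a₁ b m h h₁ h₂ => ?_⟩
  rw [conjOp_Elax]
  refine norm_add₃_le.trans ?_
  rw [norm_smul, norm_smul, norm_smul, Real.norm_eq_abs, Real.norm_eq_abs, Real.norm_eq_abs]
  calc _ ≤ m * ‖conjOp k (Elax 1 0 0)‖ + m * ‖conjOp k (Elax 0 1 0)‖
        + m * ‖conjOp k (Elax 0 0 1)‖ := by gcongr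
    _ = _ := by ring

lemma exists_norm_conjOp_Nlax_le (k : ℂ) : ∃ A, 0 ≤ A ∧ ∀ a a₁ a₂ b b₁ m : ℝ, |a| ≤ m →
    |a₁| ≤ m → |a₂| ≤ m → |b| ≤ m → |b₁| ≤ m → ‖conjOp k (Nlax a a₁ a₂ b b₁)‖ ≤ A * m := by
  refine ⟨‖conjOp k (Nlax 1 0 0 0 0)‖ + ‖conjOp k (Nlax 0 1 0 0 0)‖
    + ‖conjOp k (Nlax 0 0 1 0 0)‖ + ‖conjOp k (Nlax 0 0 0 1 0)‖ + ‖conjOp k (Nlax 0 0 0 0 1)‖,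
    by positivity, fun a a₁ a₂ b b₁ m h h₁ h₂ h₃ h₄ => ?_⟩
  rw [conjOp_Nlax]
  refine (norm_add_le _ _).trans ((add_le_add_left (norm_add₄_le) _).trans ?_)
  simp only [norm_smul, Real.norm_eq_abs]
  calc _ ≤ m * ‖conjOp k (Nlax 1 0 0 0 0)‖ + m * ‖conjOp k (Nlax 0 1 0 0 0)‖
        + m * ‖conjOp k (Nlax 0 0 1 0 0)‖ + m * ‖conjOp k (Nlax 0 0 0 1 0)‖
        + m * ‖conjOp k (Nlax 0 0 0 0 1)‖ := by gcongr
    _ = _ := by ring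

section Solution

variable {T : ℝ} {u v : ℝ → ℝ → ℝ} {u0 v0 tu0 tu1 tu2 tv0 : ℝ → ℝ}

lemma dxn_zero (w : ℝ → ℝ → ℝ) (t : ℝ) : dxn 0 w t = fun y => w y t := by
  ext y
  simp [dxn]

lemma IsSolSystem.exists_decay (h : IsSolSystem T u v u0 v0 tu0 tu1 tu2 tv0) :
    ∃ C, 0 ≤ C ∧ ∀ n ≤ 3, ∀ x ∈ Ici (0:ℝ), ∀ t ∈ Icc (0:ℝ) T,
      |dxn n u t x| ≤ C / (1 + x) ^ 3 ∧ |dxn n v t x| ≤ C / (1 + x) ^ 3 := by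
  obtain ⟨C, hC⟩ := h.2.2.2.2.2 3 (by norm_num)
  refine ⟨|C|, abs_nonneg C, fun n hn x hx t ht => ?_⟩
  have hx0 : (0:ℝ) ≤ x := hx
  have h1 := Finset.single_le_sum
    (f := fun i => (1 + x) ^ 3 * (|dxn i u t x| + |dxn i v t x|))
    (fun i _ => by positivity) (Finset.mem_range.2 (Nat.lt_succ_of_le hn))
  have h2 : (1 + x) ^ 3 * (|dxn n u t x| + |dxn n v t x|) ≤ |C| :=
    (h1.trans (hC x hx t ht)).trans (le_abs_self C)
  have hp : 0 < (1 + x) ^ 3 := by positivity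
  constructor
  · rw [le_div_iff₀ hp, mul_comm]
    exact (mul_le_mul_of_nonneg_left (le_add_of_nonneg_right (abs_nonneg _)) hp.le).trans h2
  · rw [le_div_iff₀ hp, mul_comm]
    exact (mul_le_mul_of_nonneg_left (le_add_of_nonneg_left (abs_nonneg _)) hp.le).trans h2

lemma IsSolSystem.hasDerivWithinAt_u (h : IsSolSystem T u v u0 v0 tu0 tu1 tu2 tv0)
    {x t : ℝ} (hx : x ∈ Ici (0:ℝ)) (ht : t ∈ Icc 0 T) :
    HasDerivWithinAt (fun s => u x s) (dxn 1 v t x) (Icc 0 T) t := by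
  rw [← (h.2.2.1 x hx t ht).2]
  exact hasDerivWithinAt_dt1 h.1 hx ht

lemma IsSolSystem.hasDerivWithinAt_dxn_u (hT : 0 < T)
    (h : IsSolSystem T u v u0 v0 tu0 tu1 tu2 tv0)
    {x t : ℝ} (hx : x ∈ Ici (0:ℝ)) (ht : t ∈ Icc 0 T) :
    HasDerivWithinAt (fun s => dxn 1 u s x) (dxn 2 v t x) (Icc 0 T) t := by
  have h1 := hasDerivWithinAt_dt_dxn_one hT h.1 hx ht
  have h2 : ∀ y ∈ Ici (0:ℝ), dt1 T u y t = dxn 1 v t y := fun y hy => (h.2.2.1 y hy t ht).2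
  rwa [derivWithin_congr h2 (h2 x hx),
    (hasDerivWithinAt_dxn hT h.2.1 1 hx ht).derivWithin (uniqueDiffOn_Ici 0 x hx)] at h1

lemma IsSolSystem.hasDerivWithinAt_v (hT : 0 < T)
    (h : IsSolSystem T u v u0 v0 tu0 tu1 tu2 tv0)
    {x t : ℝ} (hx : x ∈ Ici (0:ℝ)) (ht : t ∈ Icc 0 T) :
    HasDerivWithinAt (fun s => v x s)
      (dxn 1 u t x + 2 * u x t * dxn 1 u t x + dxn 3 u t x) (Icc 0 T) t := by
  have h1 := hasDerivWithinAt_dt1 h.2.1 hx ht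
  have h0 : HasDerivWithinAt (fun y => u y t) (dxn 1 u t x) (Ici 0) x := by
    rw [← dxn_zero]
    exact hasDerivWithinAt_dxn hT h.1 0 hx ht
  have h2 : dxn 1 (fun y s => u y s ^ 2) t x = 2 * u x t * dxn 1 u t x := by
    rw [dxn, iteratedDerivWithin_one, (h0.fun_pow 2).derivWithin (uniqueDiffOn_Ici 0 x hx)]
    simp
  rwa [(h.2.2.1 x hx t ht).1, h2] at h1

lemma IsSolSystem.NmatW_eq (hT : 0 < T) (h : IsSolSystem T u v u0 v0 tu0 tu1 tu2 tv0)
    {t : ℝ} (ht : t ∈ Icc 0 T) :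
    NmatW T tu0 tu1 tu2 tv0 t
      = Nlax (u 0 t) (dxn 1 u t 0) (dxn 2 u t 0) (v 0 t) (dxn 1 v t 0) := by
  have h0 : (0:ℝ) ∈ Ici (0:ℝ) := mem_Ici.2 le_rfl
  have hd : derivWithin tu0 (Icc 0 T) t = dxn 1 v t 0 := by
    have e : ∀ s ∈ Icc 0 T, tu0 s = u 0 s := fun s hs => (h.2.2.2.2.1 s hs).1.symm
    rw [derivWithin_congr e (e t ht)]
    exact (h.hasDerivWithinAt_u h0 ht).derivWithin (uniqueDiffOn_Icc hT t ht)
  obtain ⟨e1, e2, e3, e4⟩ := h.2.2.2.2.1 t ht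
  rw [e1, e2, e3, e4, ← hd]
  rfl

/-- Columns of the normalized eigenfunction evaluated at the boundary `x = 0` satisfy the
temporal part of the Lax pair. -/
theorem IsSolSystem.hasDerivWithinAt_column (hT : 0 < T)
    (h : IsSolSystem T u v u0 v0 tu0 tu1 tu2 tv0) {k : ℂ} (hk : k ∉ Qhat) {j : Fin 3}
    (hre : ∀ i, (lf j k).re ≤ (lf i k).re) {c : ℝ → ℝ → Fin 3 → ℂ}
    (hc : ∀ t ∈ Icc 0 T, SolvesXColSol u v t k j (c t)) {t : ℝ} (ht : t ∈ Icc 0 T) :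
    HasDerivWithinAt (fun s => c s 0)
      (opOf (diagonal fun i => zf i k - zf j k) (c t 0)
        + opOf (VmatW T tu0 tu1 tu2 tv0 t k) (c t 0)) (Icc 0 T) t := by
  obtain ⟨C, hC0, hC⟩ := h.exists_decay
  obtain ⟨A, hA0, hA⟩ := exists_norm_conjOp_Elax_le k
  obtain ⟨B, hB0, hB⟩ := exists_norm_conjOp_Nlax_le k
  have hd : ∀ i, 0 ≤ (lf i k - lf j k).re := fun i => by simpa using hre i
  have hpow : ∀ x : ℝ, 0 ≤ x → ∀ D : ℝ, 0 ≤ D → D / (1 + x) ^ 3 ≤ D / (1 + x) ^ 2 := by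
    intro x hx D hD
    gcongr
    · linarith
    · norm_num
  have hpow1 : ∀ x : ℝ, 0 ≤ x → C / (1 + x) ^ 3 ≤ C := by
    intro x hx
    exact div_le_self hC0 (one_le_pow₀ (by linarith))
  have hu : ∀ n ≤ 3, ∀ x ∈ Ici (0:ℝ), ∀ s ∈ Icc (0:ℝ) T, |dxn n u s x| ≤ C / (1 + x) ^ 3 :=
    fun n hn x hx s hs => (hC n hn x hx s hs).1
  have hv : ∀ n ≤ 3, ∀ x ∈ Ici (0:ℝ), ∀ s ∈ Icc (0:ℝ) T, |dxn n v s x| ≤ C / (1 + x) ^ 3 :=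
    fun n hn x hx s hs => (hC n hn x hx s hs).2
  have hu0' : ∀ x ∈ Ici (0:ℝ), ∀ s ∈ Icc (0:ℝ) T, |u x s| ≤ C / (1 + x) ^ 3 := by
    intro x hx s hs
    simpa [dxn_zero] using hu 0 (by norm_num) x hx s hs
  have hv0' : ∀ x ∈ Ici (0:ℝ), ∀ s ∈ Icc (0:ℝ) T, |v x s| ≤ C / (1 + x) ^ 3 := by
    intro x hx s hs
    simpa [dxn_zero] using hv 0 (by norm_num) x hx s hs
  set D := 2 * C + 2 * C * C with hD
  have hCD : C ≤ D := by nlinarith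
  have hD0 : 0 ≤ D := hC0.trans hCD
  have hvt : ∀ x ∈ Ici (0:ℝ), ∀ s ∈ Icc (0:ℝ) T,
      |dxn 1 u s x + 2 * u x s * dxn 1 u s x + dxn 3 u s x| ≤ D / (1 + x) ^ 3 := by
    intro x hx s hs
    have h1 := hu 1 (by norm_num) x hx s hs
    have h3 := hu 3 (by norm_num) x hx s hs
    have h0 := (hu0' x hx s hs).trans (hpow1 x hx)
    calc _ ≤ |dxn 1 u s x| + |2 * u x s * dxn 1 u s x| + |dxn 3 u s x| := abs_add_three _ _ _
      _ = |dxn 1 u s x| + 2 * |u x s| * |dxn 1 u s x| + |dxn 3 u s x| := by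
          rw [abs_mul, abs_mul, abs_two]
      _ ≤ C / (1 + x) ^ 3 + 2 * C * (C / (1 + x) ^ 3) + C / (1 + x) ^ 3 := by gcongr
      _ = _ := by rw [hD]; ring
  have hnorm_U : ∀ s ∈ Icc 0 T, ∀ x, 0 ≤ x →
      ‖conjOp k (Elax (u x s) (dxn 1 u s x) (v x s))‖ ≤ A * D / (1 + x) ^ 2 := by
    intro s hs x hx
    rw [mul_div_assoc]
    have hle : C / (1 + x) ^ 3 ≤ D / (1 + x) ^ 2 := (hpow x hx C hC0).trans (by gcongr)
    exact hA _ _ _ _ ((hu0' x hx s hs).trans hle) ((hu 1 (by norm_num) x hx s hs).trans hle)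
      ((hv0' x hx s hs).trans hle)
  have hcu : ∀ n, ∀ s ∈ Icc 0 T, ContinuousOn (dxn n u s) (Ici 0) := fun n s hs x hx =>
    (hasDerivWithinAt_dxn hT h.1 n hx hs).continuousWithinAt
  have hcv : ∀ n, ∀ s ∈ Icc 0 T, ContinuousOn (dxn n v s) (Ici 0) := fun n s hs x hx =>
    (hasDerivWithinAt_dxn hT h.2.1 n hx hs).continuousWithinAt
  have hcu0 : ∀ s ∈ Icc 0 T, ContinuousOn (fun x => u x s) (Ici 0) := fun s hs => by
    rw [← dxn_zero]
    exact hcu 0 s hs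
  have hcv0 : ∀ s ∈ Icc 0 T, ContinuousOn (fun x => v x s) (Ici 0) := fun s hs => by
    rw [← dxn_zero]
    exact hcv 0 s hs
  have hcU : ∀ s ∈ Icc 0 T,
      ContinuousOn (fun x => conjOp k (Elax (u x s) (dxn 1 u s x) (v x s))) (Ici 0) := by
    intro s hs
    simp only [conjOp_Elax k (u _ s)]
    exact (((hcu0 s hs).smul continuousOn_const).add
      ((hcu 1 s hs).smul continuousOn_const)).add ((hcv0 s hs).smul continuousOn_const)
  have hcc : ∀ s ∈ Icc 0 T, ContinuousOn (c s) (Ici 0) := fun s hs =>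
    continuousOn_pi.2 (hc s hs).1
  have hvol : ∀ s ∈ Icc 0 T, ∀ i, (∀ x > 0, HasDerivAt (fun x => c s x i)
      ((lf i k - lf j k) * (c s x i - if i = j then 1 else 0)
        + conjOp k (Elax (u x s) (dxn 1 u s x) (v x s)) (c s x) i) x) ∧
      Tendsto (fun x => c s x i) atTop (𝓝 (if i = j then 1 else 0)) := by
    intro s hs i
    obtain ⟨K, hK⟩ := (hc s hs).2.1
    refine volterra_hasDerivAt (hd i) (K := A * D * K)
      (continuousOn_pi.1 ((hcU s hs).clm_apply (hcc s hs)) i) ?_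
      (fun x hx => (hc s hs).2.2 x hx i)
    intro x hx
    calc _ ≤ ‖conjOp k (Elax (u x s) (dxn 1 u s x) (v x s)) (c s x)‖ := norm_le_pi_norm _ i
      _ ≤ ‖conjOp k (Elax (u x s) (dxn 1 u s x) (v x s))‖ * ‖c s x‖ :=
          ContinuousLinearMap.le_opNorm _ _
      _ ≤ A * D / (1 + x) ^ 2 * K := by
          gcongr
          · exact hnorm_U s hs x hx
          · exact hK x hx
      _ = _ := by ring
  obtain ⟨K, hK⟩ := (hc t ht).2.1
  have key := column_flow ht hd (T := T) (Z := opOf (diagonal fun i => zf i k - zf j k))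
    (U := fun s x => conjOp k (Elax (u x s) (dxn 1 u s x) (v x s)))
    (Ut := fun x => conjOp k (Elax (dxn 1 v t x) (dxn 2 v t x)
      (dxn 1 u t x + 2 * u x t * dxn 1 u t x + dxn 3 u t x)))
    (V := fun x => conjOp k (Nlax (u x t) (dxn 1 u t x) (dxn 2 u t x) (v x t) (dxn 1 v t x)))
    (Vx := fun x => conjOp k (Nlax (dxn 1 u t x) (dxn 2 u t x) (dxn 3 u t x) (dxn 1 v t x)
      (dxn 2 v t x)))
    (b := fun i => if i = j then 1 else 0) (c := c) (C := A * D) (K := K) (B := B * C)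
    hcc ?_ ?_ hK ?_ hnorm_U ?_ ?_ ?_ ?_ ?_ ?_ ?_
  · rw [VmatW, h.NmatW_eq hT ht]
    exact key
  · intro s hs x hx
    rw [hasDerivAt_pi]
    intro i
    refine ((hvol s hs i).1 x hx).congr_deriv ?_
    rw [Pi.add_apply, opOf_apply, Matrix.mulVec_diagonal]
    by_cases hij : i = j
    · simp [hij]
    · simp [hij]
  · exact fun s hs => tendsto_pi_nhds.2 fun i => (hvol s hs i).2
  · ext i
    rw [opOf_apply, Matrix.mulVec_diagonal]
    by_cases hij : i = j
    · simp [hij]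
    · simp [hij]
  · intro x hx
    rw [mul_div_assoc]
    have hx' : x ∈ Ici (0:ℝ) := hx.le
    have hle : C / (1 + x) ^ 3 ≤ D / (1 + x) ^ 2 := (hpow x hx.le C hC0).trans (by gcongr)
    exact hA _ _ _ _ ((hv 1 (by norm_num) x hx' t ht).trans hle)
      ((hv 2 (by norm_num) x hx' t ht).trans hle)
      ((hvt x hx' t ht).trans (hpow x hx.le D hD0))
  · intro ε hε
    have hjc : ∀ n, ContinuousOn (fun p : ℝ × ℝ => dxn n u p.2 p.1) (halfStrip T) := fun n =>
      (contDiffOn_dxn hT h.1 n).continuousOn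
    have hjv : ∀ n, ContinuousOn (fun p : ℝ × ℝ => dxn n v p.2 p.1) (halfStrip T) := fun n =>
      (contDiffOn_dxn hT h.2.1 n).continuousOn
    have hε' : 0 < ε / (A + 1) := by positivity
    obtain ⟨δ₁, hδ₁, H₁⟩ := uniform_taylor (f := fun s x => u x s) (f' := dxn 1 v)
      (fun x hx s hs => h.hasDerivWithinAt_u hx hs) (hjv 1) (hv 1 (by norm_num)) ht hε'
    obtain ⟨δ₂, hδ₂, H₂⟩ := uniform_taylor (f := dxn 1 u) (f' := dxn 2 v)
      (fun x hx s hs => h.hasDerivWithinAt_dxn_u hT hx hs) (hjv 2) (hv 2 (by norm_num)) ht hε'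
    obtain ⟨δ₃, hδ₃, H₃⟩ := uniform_taylor (f := fun s x => v x s)
      (f' := fun s x => dxn 1 u s x + 2 * u x s * dxn 1 u s x + dxn 3 u s x)
      (fun x hx s hs => h.hasDerivWithinAt_v hT hx hs)
      (((hjc 1).add ((continuousOn_const.mul h.1.continuousOn).mul (hjc 1))).add (hjc 3))
      hvt ht hε'
    refine ⟨min δ₁ (min δ₂ δ₃), by positivity, fun s hs hst x hx => ?_⟩
    have hx' : x ∈ Ici (0:ℝ) := hx.le
    rw [lt_min_iff, lt_min_iff] at hst
    have hlin : conjOp k (Elax (u x s) (dxn 1 u s x) (v x s))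
        - conjOp k (Elax (u x t) (dxn 1 u t x) (v x t))
        - (s - t) • conjOp k (Elax (dxn 1 v t x) (dxn 2 v t x)
          (dxn 1 u t x + 2 * u x t * dxn 1 u t x + dxn 3 u t x))
        = conjOp k (Elax (u x s - u x t - (s - t) * dxn 1 v t x)
          (dxn 1 u s x - dxn 1 u t x - (s - t) * dxn 2 v t x)
          (v x s - v x t - (s - t) * (dxn 1 u t x + 2 * u x t * dxn 1 u t x + dxn 3 u t x))) := by
      rw [conjOp_Elax k (u x s), conjOp_Elax k (u x t), conjOp_Elax k (dxn 1 v t x),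
        conjOp_Elax k (u x s - u x t - (s - t) * dxn 1 v t x)]
      module
    simp only [hlin]
    refine (hA _ _ _ (ε / (A + 1) * |s - t| / (1 + x) ^ 2) (H₁ s hs hst.1 x hx')
      (H₂ s hs hst.2.1 x hx') (H₃ s hs hst.2.2 x hx')).trans ?_
    rw [← mul_div_assoc, ← mul_assoc]
    gcongr
    rw [← mul_div_assoc, div_le_iff₀ (by positivity)]
    nlinarith
  · simp only [conjOp_Nlax k (u _ t)]
    exact (((((hcu0 t ht).smul continuousOn_const).add
      ((hcu 1 t ht).smul continuousOn_const)).add ((hcu 2 t ht).smul continuousOn_const)).add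
      ((hcv0 t ht).smul continuousOn_const)).add ((hcv 1 t ht).smul continuousOn_const)
  · intro x hx
    have hnhds : Ici (0:ℝ) ∈ 𝓝 x := Ici_mem_nhds hx
    have hdu : ∀ n, HasDerivAt (dxn n u t) (dxn (n + 1) u t x) x := fun n =>
      (hasDerivWithinAt_dxn hT h.1 n hx.le ht).hasDerivAt hnhds
    have hdv1 : HasDerivAt (dxn 1 v t) (dxn 2 v t x) x :=
      (hasDerivWithinAt_dxn hT h.2.1 1 hx.le ht).hasDerivAt hnhds
    have hdu0 : HasDerivAt (fun y => u y t) (dxn 1 u t x) x := by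
      rw [← dxn_zero]
      exact hdu 0
    have hdv0 : HasDerivAt (fun y => v y t) (dxn 1 v t x) x := by
      rw [← dxn_zero]
      exact (hasDerivWithinAt_dxn hT h.2.1 0 hx.le ht).hasDerivAt hnhds
    simp only [conjOp_Nlax k (u _ t), conjOp_Nlax k (dxn 1 u t x)]
    exact ((((hdu0.smul_const _).add ((hdu 1).smul_const _)).add ((hdu 2).smul_const _)).add
      (hdv0.smul_const _)).add (hdv1.smul_const (conjOp k (Nlax 0 0 0 0 1)))
  · have hz : Tendsto (fun x : ℝ => B * (C / (1 + x) ^ 3)) atTop (𝓝 0) := by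
      have h1 : Tendsto (fun x : ℝ => (1 + x) ^ 3) atTop atTop :=
        (tendsto_pow_atTop (by norm_num)).comp (tendsto_atTop_add_const_left _ 1 tendsto_id)
      simpa using (h1.const_div_atTop C).const_mul B
    refine squeeze_zero_norm' ?_ hz
    filter_upwards [eventually_ge_atTop 0] with x hx
    exact hB _ _ _ _ _ _ (hu0' x hx t ht) (hu 1 (by norm_num) x hx t ht)
      (hu 2 (by norm_num) x hx t ht) (hv0' x hx t ht) (hv 1 (by norm_num) x hx t ht)
  · intro x hx
    refine (hB _ _ _ _ _ (C / (1 + x) ^ 3) (hu0' x hx t ht) (hu 1 (by norm_num) x hx t ht)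
      (hu 2 (by norm_num) x hx t ht) (hv0' x hx t ht) (hv 1 (by norm_num) x hx t ht)).trans ?_
    gcongr
    exact hpow1 x hx
  · intro x hx w
    exact lax_flat_conj hk (u x t) (dxn 1 u t x) (dxn 2 u t x) (dxn 3 u t x) (v x t)
      (dxn 1 v t x) (dxn 2 v t x) j w

end Solution

lemma eqOn_of_linear_ode {E : Type*} [NormedAddCommGroup E] [NormedSpace ℝ E] {T : ℝ}
    {W : ℝ → E →L[ℝ] E} (hW : ContinuousOn W (Icc 0 T)) {f g : ℝ → E}
    (hf : ∀ t ∈ Icc 0 T, HasDerivWithinAt f (W t (f t)) (Icc 0 T) t)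
    (hg : ∀ t ∈ Icc 0 T, HasDerivWithinAt g (W t (g t)) (Icc 0 T) t)
    (hfg : f 0 = g 0 ∨ f T = g T) : EqOn f g (Icc 0 T) := by
  obtain ⟨K, hK⟩ := isCompact_Icc.exists_bound_of_continuousOn hW
  have hlip : ∀ t ∈ Icc 0 T, LipschitzOnWith K.toNNReal (fun y => W t y) univ := by
    intro t ht
    refine ((W t).lipschitz.weaken ?_).lipschitzOnWith
    rw [← NNReal.coe_le_coe, coe_nnnorm]
    exact (hK t ht).trans (Real.le_coe_toNNReal K)
  have hfc : ContinuousOn f (Icc 0 T) := fun t ht => (hf t ht).continuousWithinAt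
  have hgc : ContinuousOn g (Icc 0 T) := fun t ht => (hg t ht).continuousWithinAt
  rcases hfg with h | h
  · exact ODE_solution_unique_of_mem_Icc_right (v := fun t y => W t y) (s := fun _ => univ)
      (fun t ht => hlip t (Ico_subset_Icc_self ht)) hfc
      (fun t ht => (hf t (Ico_subset_Icc_self ht)).mono_of_mem_nhdsWithin
        (Icc_mem_nhdsGE_of_mem ht)) (fun _ _ => mem_univ _) hgc
      (fun t ht => (hg t (Ico_subset_Icc_self ht)).mono_of_mem_nhdsWithin
        (Icc_mem_nhdsGE_of_mem ht)) (fun _ _ => mem_univ _) h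
  · exact ODE_solution_unique_of_mem_Icc_left (v := fun t y => W t y) (s := fun _ => univ)
      (fun t ht => hlip t (Ioc_subset_Icc_self ht)) hfc
      (fun t ht => (hf t (Ioc_subset_Icc_self ht)).mono_of_mem_nhdsWithin
        (Icc_mem_nhdsLE_of_mem ht)) (fun _ _ => mem_univ _) hgc
      (fun t ht => (hg t (Ioc_subset_Icc_self ht)).mono_of_mem_nhdsWithin
        (Icc_mem_nhdsLE_of_mem ht)) (fun _ _ => mem_univ _) h

lemma hasDerivWithinAt_of_finite_volterra {T : ℝ} {a δ : ℂ} {G y : ℝ → ℂ}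
    (hG : ContinuousOn G (Icc 0 T))
    (hy : ∀ t ∈ Icc 0 T, y t = δ - ∫ t' in t..T, Complex.exp (((t : ℂ) - (t' : ℂ)) * a) * G t')
    {t : ℝ} (ht : t ∈ Icc 0 T) :
    HasDerivWithinAt y (a * (y t - δ) + G t) (Icc 0 T) t := by
  have hT : 0 ≤ T := ht.1.trans ht.2
  set H : ℝ → ℂ := IccExtend hT ((Icc 0 T).domRestrict fun t' => Complex.exp (-(t' : ℂ) * a) * G t')
    with hH
  have hHc : Continuous H := by
    refine Continuous.Icc_extend' (ContinuousOn.domRestrict (ContinuousOn.mul ?_ hG))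
    fun_prop
  have hHe : ∀ s ∈ Icc 0 T, H s = Complex.exp (-(s : ℂ) * a) * G s := fun s hs => by
    rw [hH, IccExtend_of_mem _ _ hs]
    rfl
  have hye : ∀ s ∈ Icc 0 T, y s = δ - Complex.exp ((s : ℂ) * a) * ∫ t' in s..T, H t' := by
    intro s hs
    rw [hy s hs, ← intervalIntegral.integral_const_mul]
    congr 1
    refine intervalIntegral.integral_congr fun r hr => ?_
    have hr' : r ∈ Icc 0 T := uIcc_subset_Icc hs (right_mem_Icc.2 hT) hr
    simp only [hHe r hr']
    rw [← mul_assoc, ← Complex.exp_add]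
    congr 2
    ring
  have h1 : HasDerivAt (fun s : ℝ => ∫ t' in s..T, H t') (-H t) t :=
    intervalIntegral.integral_hasDerivAt_left (hHc.intervalIntegrable _ _)
      hHc.aestronglyMeasurable.stronglyMeasurableAtFilter hHc.continuousAt
  have h2 : HasDerivAt (fun s : ℝ => Complex.exp ((s : ℂ) * a))
      (Complex.exp ((t : ℂ) * a) * a) t := by
    simpa using ((Complex.ofRealCLM.hasDerivAt (x := t)).mul_const a).cexp
  refine (((h2.fun_mul h1).const_sub δ).hasDerivWithinAt.congr hye (hye t ht)).congr_deriv ?_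
  rw [hye t ht, hHe t ht]
  have h3 : Complex.exp ((t : ℂ) * a) * Complex.exp (-(t : ℂ) * a) = 1 := by
    rw [← Complex.exp_add]
    simp
  linear_combination G t * h3

/-- The normalized fundamental matrix of the temporal equation transports its solutions
from time `T` to time `0`. -/
theorem inv_mulVec_of_temporal_volterra {T : ℝ} (hT : 0 ≤ T) {z : Fin 3 → ℂ} {ζ : ℂ}
    {V M : ℝ → Matrix (Fin 3) (Fin 3) ℂ} (hV : ContinuousOn (fun t => opOf (V t)) (Icc 0 T))
    (hMc : ∀ i j : Fin 3, ContinuousOn (fun t => M t i j) (Icc 0 T))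
    (hM : ∀ t ∈ Icc (0:ℝ) T, ∀ i j : Fin 3, M t i j = (if i = j then 1 else 0) -
      ∫ t' in t..T, Complex.exp (((t : ℂ) - (t' : ℂ)) * (z i - z j)) * (V t' * M t') i j)
    {c : ℝ → Fin 3 → ℂ}
    (hc : ∀ t ∈ Icc 0 T, HasDerivWithinAt c
      (opOf (diagonal fun i => z i - ζ) (c t) + opOf (V t) (c t)) (Icc 0 T) t) (i : Fin 3) :
    ((M 0)⁻¹ *ᵥ c 0) i = Complex.exp (-(T : ℂ) * (z i - ζ)) * c T i := by
  have h0 : (0:ℝ) ∈ Icc 0 T := left_mem_Icc.2 hT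
  have hMd : ∀ t ∈ Icc 0 T, ∀ i j, HasDerivWithinAt (fun s => M s i j)
      ((z i - z j) * M t i j + (V t * M t) i j) (Icc 0 T) t := by
    intro t ht i j
    have hG : ContinuousOn (fun s => (V s * M s) i j) (Icc 0 T) :=
      continuousOn_pi.1 (hV.clm_apply (continuousOn_pi.2 fun m => hMc m j)) i
    refine (hasDerivWithinAt_of_finite_volterra hG (fun s hs => hM s hs i j) ht).congr_deriv ?_
    by_cases hij : i = j
    · simp [hij]
    · simp [hij]
  have hMT : M T = 1 := by
    ext i j
    rw [hM T (right_mem_Icc.2 hT) i j, intervalIntegral.integral_same, sub_zero,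
      Matrix.one_apply]
  set e : (Fin 3 → ℂ) → ℝ → Fin 3 → ℂ := fun y t m =>
    Complex.exp (((t : ℂ) - (T : ℂ)) * (z m - ζ)) * y m with he
  have hwd : ∀ y, ∀ t ∈ Icc 0 T, HasDerivWithinAt (fun s => M s *ᵥ e y s)
      ((opOf (diagonal fun i => z i - ζ) + opOf (V t)) (M t *ᵥ e y t)) (Icc 0 T) t := by
    intro y t ht
    rw [hasDerivWithinAt_pi]
    intro i
    have hed : ∀ m, HasDerivAt (fun s : ℝ => e y s m) ((z m - ζ) * e y t m) t := by
      intro m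
      have h := ((((Complex.ofRealCLM.hasDerivAt (x := t)).sub_const (T : ℂ)).mul_const
        (z m - ζ)).cexp).mul_const (y m)
      refine h.congr_deriv ?_
      simp [he]
      ring
    have h := HasDerivWithinAt.fun_sum (u := Finset.univ) fun m _ =>
      (hMd t ht i m).fun_mul (hed m).hasDerivWithinAt
    refine h.congr_deriv ?_
    rw [_root_.add_apply, Pi.add_apply, opOf_apply, opOf_apply, Matrix.mulVec_diagonal,
      Matrix.mulVec_mulVec, Matrix.mulVec, Matrix.mulVec, dotProduct, dotProduct, Finset.mul_sum,
      ← Finset.sum_add_distrib]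
    refine Finset.sum_congr rfl fun m _ => ?_
    ring
  have hW : ContinuousOn (fun t => opOf (diagonal fun i => z i - ζ) + opOf (V t)) (Icc 0 T) :=
    continuousOn_const.add hV
  have heT : ∀ y, M T *ᵥ e y T = y := by
    intro y
    rw [hMT, Matrix.one_mulVec]
    ext m
    simp [he]
  have htransport : M 0 *ᵥ e (c T) 0 = c 0 :=
    eqOn_of_linear_ode hW (hwd (c T)) hc (Or.inr (heT (c T))) h0
  have hinj : IsUnit (M 0).det := by
    rw [isUnit_iff_ne_zero]
    intro hdet
    obtain ⟨x, hx, hMx⟩ := Matrix.exists_mulVec_eq_zero_iff.2 hdet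
    set y : Fin 3 → ℂ := fun m => Complex.exp ((T : ℂ) * (z m - ζ)) * x m with hy
    have hey : e y 0 = x := by
      ext m
      simp only [he, hy]
      rw [← mul_assoc, ← Complex.exp_add]
      simp
    have hzero := eqOn_of_linear_ode hW (hwd y) (g := fun _ => 0)
      (fun t _ => by simpa using hasDerivWithinAt_const t (Icc 0 T) (0 : Fin 3 → ℂ))
      (Or.inl (by rw [hey, hMx])) (right_mem_Icc.2 hT)
    simp only [heT] at hzero
    apply hx
    ext m
    have := congrFun hzero m
    simpa [hy] using this
  rw [← htransport, Matrix.mulVec_mulVec, Matrix.nonsing_inv_mul _ hinj, Matrix.one_mulVec]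
  simp [he]

lemma IsSolSystem.continuousOn_VmatW {T : ℝ} (hT : 0 < T) {u v : ℝ → ℝ → ℝ}
    {u0 v0 tu0 tu1 tu2 tv0 : ℝ → ℝ} (h : IsSolSystem T u v u0 v0 tu0 tu1 tu2 tv0) (k : ℂ) :
    ContinuousOn (fun t => opOf (VmatW T tu0 tu1 tu2 tv0 t k)) (Icc 0 T) := by
  have hmap : MapsTo (fun t : ℝ => ((0:ℝ), t)) (Icc 0 T) (halfStrip T) := fun t ht =>
    mk_mem_prod (mem_Ici.2 le_rfl) ht
  have hline : ContinuousOn (fun t : ℝ => ((0:ℝ), t)) (Icc 0 T) := by fun_prop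
  have hu : ∀ n, ContinuousOn (fun t => dxn n u t 0) (Icc 0 T) := fun n =>
    (contDiffOn_dxn hT h.1 n).continuousOn.comp hline hmap
  have hv : ∀ n, ContinuousOn (fun t => dxn n v t 0) (Icc 0 T) := fun n =>
    (contDiffOn_dxn hT h.2.1 n).continuousOn.comp hline hmap
  have hu0 : ContinuousOn (fun t => u 0 t) (Icc 0 T) := h.1.continuousOn.comp hline hmap
  have hv0 : ContinuousOn (fun t => v 0 t) (Icc 0 T) := h.2.1.continuousOn.comp hline hmap
  have hN : ContinuousOn (fun t => conjOp k
      (Nlax (u 0 t) (dxn 1 u t 0) (dxn 2 u t 0) (v 0 t) (dxn 1 v t 0))) (Icc 0 T) := by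
    simp only [conjOp_Nlax k (u 0 _)]
    exact ((((hu0.smul continuousOn_const).add ((hu 1).smul continuousOn_const)).add
      ((hu 2).smul continuousOn_const)).add (hv0.smul continuousOn_const)).add
      ((hv 1).smul continuousOn_const)
  refine hN.congr fun t ht => ?_
  rw [VmatW, h.NmatW_eq hT ht]
  rfl

/-- the global relation (S⁻¹s)(k) = e^{−T Ẑ(k)} μ₃(0,T,k), entrywise,
where s(k) = μ₃(0,0,k) and S(k) = μ₁(0,k). -/
theorem statement17 (T : ℝ) (hT : 0 < T) (u v : ℝ → ℝ → ℝ)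
    (u0 v0 tu0 tu1 tu2 tv0 : ℝ → ℝ)
    (hu0 : SchwartzHalfW u0) (hv0 : SchwartzHalfW v0)
    (htu0 : SmoothOnIcc T tu0) (htu1 : SmoothOnIcc T tu1)
    (htu2 : SmoothOnIcc T tu2) (htv0 : SmoothOnIcc T tv0)
    (hsol : IsSolSystem T u v u0 v0 tu0 tu1 tu2 tv0)
    (μ3 : ℝ → ℝ → ℂ → Matrix (Fin 3) (Fin 3) ℂ)
    (μ1 : ℝ → ℂ → Matrix (Fin 3) (Fin 3) ℂ)
    (hμ3 : ∀ t ∈ Icc (0:ℝ) T, ∀ j : Fin 3, ∀ k ∈ domS3 j \ Qhat,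
      SolvesXColSol u v t k j (fun x i => μ3 x t k i j))
    (hμ1 : ∀ k ∉ Qhat, SolvesTW T tu0 tu1 tu2 tv0 k (fun t => μ1 t k)) :
    ∀ j : Fin 3, ∀ k ∈ domS3 j \ Qhat, ∀ i : Fin 3,
      ((μ1 0 k)⁻¹ * μ3 0 0 k) i j
        = Complex.exp (-(T : ℂ) * (zf i k - zf j k)) * μ3 0 T k i j := by
  intro j k hk i
  exact inv_mulVec_of_temporal_volterra hT.le (hsol.continuousOn_VmatW hT k) (hμ1 k hk.2).1
    (hμ1 k hk.2).2 (c := fun t m => μ3 0 t k m j)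
    (fun t ht => hsol.hasDerivWithinAt_column hT hk.2 (re_lf_le_of_mem_domS3 hk)
      (c := fun t x m => μ3 x t k m j) (fun s hs => hμ3 s hs j k hk) ht) i
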